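/- Let d ≥ 2, α ∈ (0,1), and let μ be an α-stable distribution on ℝ^d with no shift, characteristic exponent Φ_μ(z) = |z|^α V(u_z), and spectral spherical measure λ(dv) = P(v) ω(dv), where P is the restriction to S^{d−1} of a polynomial, P ≥ 0 and P not identically zero. Then the density g of μ satisfies, as |x| → ∞, g(x) = (2αΓ(α) sin(πα/2)/π) · P(u_x)/|x|^{α+d} + O(|x|^{−2α−d}). -/

import Mathlib

open MeasureTheory Real Filter Topology
open scoped RealInnerProductSpace ENNReal NNReal

noncomputable section

namespace StablePaper

abbrev Ed (d : ℕ) : Type := EuclideanSpace ℝ (Fin d)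

abbrev Sph (d : ℕ) := Metric.sphere (0 : Ed d) 1

/-- The surface measure `ω` on the unit sphere `S^{d-1}`. -/
def ωd (d : ℕ) : Measure (Sph d) := (volume : Measure (Ed d)).toSphere

/-- `u_z = z/|z|` for `z ≠ 0`, as a point of the unit sphere. -/
def unitize {d : ℕ} (z : Ed d) (hz : z ≠ 0) : Sph d :=
  ⟨‖z‖⁻¹ • z, by
    rw [mem_sphere_iff_norm, sub_zero, norm_smul, norm_inv, norm_norm,
      inv_mul_cancel₀ (norm_ne_zero_iff.mpr hz)]⟩

/-- Negation on the unit sphere. -/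
def negS {d : ℕ} (u : Sph d) : Sph d :=
  ⟨-(u : Ed d), by
    rw [mem_sphere_iff_norm, sub_zero, norm_neg]
    have := u.2
    rwa [mem_sphere_iff_norm, sub_zero] at this⟩

/-- Rising factorial (Pochhammer symbol) `(b)_n`. -/
def risingFactorial (b : ℝ) (n : ℕ) : ℝ := ∏ i ∈ Finset.range n, (b + i)

/-- The Gegenbauer polynomial `C_j^b(t)` (for `b > 0`), via its explicit sum formula. -/
def gegenbauer (b : ℝ) (j : ℕ) (t : ℝ) : ℝ :=
  ∑ m ∈ Finset.range (j / 2 + 1),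
    (-1 : ℝ) ^ m * 2 ^ (j - 2 * m) * risingFactorial b (j - m) /
      ((Nat.factorial m : ℝ) * (Nat.factorial (j - 2 * m) : ℝ)) * t ^ (j - 2 * m)

/-- The normalized (ultraspherical) polynomial `C̃_j^b(t) = C_j^b(t)/C_j^b(1)`;
for `b = 0` it is the Chebyshev polynomial `T_j`. -/
def gegenbauerN (b : ℝ) (j : ℕ) (t : ℝ) : ℝ :=
  if b = 0 then (Polynomial.Chebyshev.T ℝ (j : ℤ)).eval t
  else gegenbauer b j t / gegenbauer b j 1

/-- `c_{j,d} = dim ℋ_{j,d}`. -/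
def cdim (d j : ℕ) : ℕ :=
  if j = 0 then 1 else Nat.choose (j + d - 2) j + Nat.choose (j + d - 3) (j - 1)

/-- The surface area `A(S^{d-1}) = 2 π^{d/2} / Γ(d/2)`. -/
def sphereArea (d : ℕ) : ℝ := 2 * Real.pi ^ ((d : ℝ) / 2) / Real.Gamma ((d : ℝ) / 2)

/-- Projection onto spherical harmonics of degree `j` (real-valued version):
`(proj_j f)(u) = (c_{j,d}/A(S^{d-1})) ∫ C̃_j^{(d-2)/2}(⟨u,v⟩) f(v) ω(dv)`. -/
def projR (d j : ℕ) (f : Sph d → ℝ) (u : Sph d) : ℝ :=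
  (cdim d j : ℝ) / sphereArea d *
    ∫ v, gegenbauerN (((d : ℝ) - 2) / 2) j ⟪(u : Ed d), (v : Ed d)⟫ * f v ∂(ωd d)

/-- Projection onto spherical harmonics of degree `j` (complex-valued version). -/
def projC (d j : ℕ) (f : Sph d → ℂ) (u : Sph d) : ℂ :=
  ((cdim d j : ℂ) / (sphereArea d : ℂ)) *
    ∫ v, (gegenbauerN (((d : ℝ) - 2) / 2) j ⟪(u : Ed d), (v : Ed d)⟫ : ℂ) * f v ∂(ωd d)

/-- The coefficients `w_j(α)`. -/
def w (d : ℕ) (α : ℝ) (j : ℕ) : ℝ :=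
  Real.pi ^ ((d : ℝ) / 2) * Real.Gamma (α + 1) /
    (2 ^ (α - 1) * Real.Gamma (((j : ℝ) + α + d) / 2) * Real.Gamma ((α - j) / 2 + 1))

/-- The characteristic exponent of an `α`-stable distribution (`α ≠ 1`) with
spectral spherical measure `Λ`. -/
def charExp (d : ℕ) (α : ℝ) (Λ : Measure (Sph d)) (z : Ed d) : ℂ :=
  ∫ v, (|⟪z, (v : Ed d)⟫| ^ α : ℝ) *
      (1 - Complex.I * (Real.tan (Real.pi * α / 2) : ℂ) *
        (Real.sign ⟪z, (v : Ed d)⟫ : ℂ)) ∂Λ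

/-- `V(u)`, so that `Φ_μ(z) = |z|^α V(u_z)`. -/
def Vfun (d : ℕ) (α : ℝ) (Λ : Measure (Sph d)) (u : Sph d) : ℂ :=
  charExp d α Λ (u : Ed d)

/-- The characteristic exponent of a `1`-stable distribution with
spectral spherical measure `Λ`. -/
def charExp1 (d : ℕ) (Λ : Measure (Sph d)) (z : Ed d) : ℂ :=
  ∫ v, ((|⟪z, (v : Ed d)⟫| : ℝ) : ℂ) +
      Complex.I * ((2 / Real.pi * (⟪z, (v : Ed d)⟫ *
        Real.log |⟪z, (v : Ed d)⟫|) : ℝ) : ℂ) ∂Λ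

/-- The spectral spherical measure `λ(dv) = P(v) ω(dv)`. -/
def specMeasure (d : ℕ) (P : Sph d → ℝ) : Measure (Sph d) :=
  (ωd d).withDensity (fun v => ENNReal.ofReal (P v))

/-- `μ` has Fourier transform `exp (-Φ)` where `Φ` is the `α`-stable characteristic
exponent with spectral spherical measure `Λ` (case `α ≠ 1`). -/
def IsStableChar (d : ℕ) (α : ℝ) (Λ : Measure (Sph d)) (μ : Measure (Ed d)) : Prop :=
  ∀ z : Ed d, ∫ x, Complex.exp (Complex.I * (⟪z, x⟫ : ℂ)) ∂μ =
    Complex.exp (- charExp d α Λ z)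

/-- `μ` has Fourier transform `exp (-Φ)` where `Φ` is the `1`-stable characteristic
exponent with spectral spherical measure `Λ`. -/
def IsStableChar1 (d : ℕ) (Λ : Measure (Sph d)) (μ : Measure (Ed d)) : Prop :=
  ∀ z : Ed d, ∫ x, Complex.exp (Complex.I * (⟪z, x⟫ : ℂ)) ∂μ =
    Complex.exp (- charExp1 d Λ z)

/-- `μ` is nondegenerate: its support is not contained in any proper affine subspace. -/
def Nondegenerate (d : ℕ) (μ : Measure (Ed d)) : Prop :=
  ∀ (a : Ed d) (W : Submodule ℝ (Ed d)), W ≠ ⊤ →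
    μ ((fun x => a + x) '' (W : Set (Ed d))) < 1

/-- `P` is the restriction to the sphere of a polynomial on `ℝ^d`. -/
def IsPolyRestriction (d : ℕ) (P : Sph d → ℝ) : Prop :=
  ∃ p : MvPolynomial (Fin d) ℝ,
    ∀ u : Sph d, P u = MvPolynomial.eval (fun i => (u : Ed d) i) p

/-- `P` is the restriction to the sphere of a polynomial of degree at most `q`. -/
def IsPolyRestrictionDeg (d q : ℕ) (P : Sph d → ℝ) : Prop :=
  ∃ p : MvPolynomial (Fin d) ℝ, p.totalDegree ≤ q ∧
    ∀ u : Sph d, P u = MvPolynomial.eval (fun i => (u : Ed d) i) p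

/-- `f` is a spherical harmonic of degree `j`: the restriction to the sphere of a
homogeneous harmonic polynomial of degree `j`. -/
def IsSphericalHarmonicC (d j : ℕ) (f : Sph d → ℂ) : Prop :=
  ∃ p : MvPolynomial (Fin d) ℂ, p.IsHomogeneous j ∧
    (∑ i : Fin d, MvPolynomial.pderiv i (MvPolynomial.pderiv i p)) = 0 ∧
    ∀ u : Sph d, f u = MvPolynomial.eval (fun i => ((u : Ed d) i : ℂ)) p

/-- `S_{j,k} = (-i)^j proj_j (V^k)`. -/
def SHk (d : ℕ) (α : ℝ) (Λ : Measure (Sph d)) (j k : ℕ) (u : Sph d) : ℂ :=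
  (-Complex.I) ^ j * projC d j (fun v => (Vfun d α Λ v) ^ k) u

/-- `S_{j,p} = (-i)^j proj_j (V^p)` for real exponents `p` (principal branch). -/
def SHp (d : ℕ) (α : ℝ) (Λ : Measure (Sph d)) (j : ℕ) (p : ℝ) (u : Sph d) : ℂ :=
  (-Complex.I) ^ j * projC d j (fun v => (Vfun d α Λ v) ^ (p : ℂ)) u

/-- `g` is the density of the stable distribution with characteristic exponent
`charExp d α Λ`, given by the Fourier inversion formula. -/
def IsDensityOf (d : ℕ) (α : ℝ) (Λ : Measure (Sph d)) (g : Ed d → ℝ) : Prop :=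
  ∀ x : Ed d, (g x : ℂ) =
    (((2 * Real.pi) ^ d)⁻¹ : ℝ) *
      ∫ z : Ed d, Complex.exp (-(Complex.I * (⟪x, z⟫ : ℂ))) *
        Complex.exp (- charExp d α Λ z)

/-- Harmonic numbers `s_n`. -/
def harmonicNum (n : ℕ) : ℝ := ∑ i ∈ Finset.range n, (1 : ℝ) / (i + 1)

def betaD (d : ℕ) : ℝ :=
  if Even d then 1 - Real.log 2 - harmonicNum (d / 2) / 2
  else 1 - harmonicNum (d + 1) + harmonicNum ((d + 1) / 2) / 2

/-- The coefficients `w*_j` (for odd `j`). -/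
def wstar (d j : ℕ) : ℝ :=
  if j = 1 then Real.pi ^ ((d : ℝ) / 2) * betaD d / Real.Gamma ((d : ℝ) / 2 + 1)
  else (-1 : ℝ) ^ ((j - 3) / 2) * Real.pi ^ ((d : ℝ) / 2) *
      Real.Gamma (((j : ℝ) - 1) / 2) / (2 * Real.Gamma (((d : ℝ) + 1 + j) / 2))

/-- The Bessel function of the first kind `J_τ`. -/
def besselJ (τ : ℝ) (x : ℝ) : ℝ :=
  ∑' k : ℕ, (-1 : ℝ) ^ k * (x / 2) ^ (2 * (k : ℝ) + τ) /
    ((Nat.factorial k : ℝ) * Real.Gamma ((k : ℝ) + τ + 1))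

/-- The `(j,k)`-term `((-2^α)^k π^{-d/2} / (k! ρ^{kα+d})) (Γ((j+kα+d)/2)/Γ((j-kα)/2)) S_{j,k}(u)`
of the spherical-harmonic series for the density (`α ∈ (0,1)`), at radius `ρ`. -/
def phiTerm (d : ℕ) (α : ℝ) (Λ : Measure (Sph d)) (j k : ℕ) (ρ : ℝ) (u : Sph d) : ℂ :=
  ((((-((2 : ℝ) ^ α)) ^ k * Real.pi ^ (-(d : ℝ) / 2) /
      ((Nat.factorial k : ℝ) * ρ ^ ((k : ℝ) * α + d)) *
      (Real.Gamma (((j : ℝ) + k * α + d) / 2) /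
        Real.Gamma (((j : ℝ) - k * α) / 2))) : ℝ) : ℂ) * SHk d α Λ j k u

/-- The `k`-th term `((-2^α)^k π^{-d/2} / (k! r^{kα+1})) (Γ((kα+d)/2)/Γ(-kα/2)) ∫ V^k dω`
of the series for the density of `|X|`. -/
def radTerm (d : ℕ) (α : ℝ) (Λ : Measure (Sph d)) (k : ℕ) (r : ℝ) : ℂ :=
  ((((-((2 : ℝ) ^ α)) ^ k * Real.pi ^ (-(d : ℝ) / 2) /
      ((Nat.factorial k : ℝ) * r ^ ((k : ℝ) * α + 1)) *
      (Real.Gamma (((k : ℝ) * α + d) / 2) / Real.Gamma (-((k : ℝ) * α) / 2))) : ℝ) : ℂ) *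
    ∫ u, (Vfun d α Λ u) ^ k ∂(ωd d)

end StablePaper

namespace StablePaper

/-- The exponential is `e^B`-Lipschitz on the half plane `re ≤ B`. -/
lemma norm_cexp_sub_cexp_le {B : ℝ} {a b : ℂ} (ha : a.re ≤ B) (hb : b.re ≤ B) :
    ‖Complex.exp a - Complex.exp b‖ ≤ Real.exp B * ‖a - b‖ := by
  refine Convex.norm_image_sub_le_of_norm_hasDerivWithin_le (s := {z : ℂ | z.re ≤ B})
    (f' := Complex.exp) (fun x _ => (Complex.hasDerivAt_exp x).hasDerivWithinAt) ?_
    (convex_halfSpace_re_le B) hb ha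
  intro x hx
  rw [Complex.norm_exp]
  exact Real.exp_le_exp.mpr hx

lemma norm_one_sub_cexp_neg_le {w : ℂ} (hw : 0 ≤ w.re) : ‖1 - Complex.exp (-w)‖ ≤ min 2 ‖w‖ := by
  refine le_min ?_ ?_
  · refine (norm_sub_le _ _).trans ?_
    rw [norm_one, Complex.norm_exp]
    have : Real.exp (-w).re ≤ 1 := Real.exp_le_one_iff.mpr (by simpa using hw)
    linarith
  · have := norm_cexp_sub_cexp_le (B := 0) (a := 0) (b := -w) (by simp) (by simpa using hw)
    simpa using this

lemma integrableOn_Ioi_min_mul_rpow {α : ℝ} (hα0 : 0 < α) (hα1 : α < 1) {K : ℝ} (hK : 0 ≤ K) :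
    IntegrableOn (fun s : ℝ => min 2 (K * s) * s ^ (-α - 1)) (Set.Ioi 0) := by
  have hmeas : Measurable (fun s : ℝ => min 2 (K * s) * s ^ (-α - 1)) := by fun_prop
  rw [← Set.Ioc_union_Ioi_eq_Ioi zero_le_one]
  refine IntegrableOn.union ?_ ?_
  · have h1 : IntegrableOn (fun s : ℝ => K * s ^ (-α)) (Set.Ioc 0 1) :=
      ((intervalIntegrable_iff_integrableOn_Ioc_of_le zero_le_one).mp
        (intervalIntegral.intervalIntegrable_rpow' (by linarith))).const_mul K
    refine Integrable.mono' h1 hmeas.aestronglyMeasurable ?_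
    refine (ae_restrict_mem measurableSet_Ioc).mono fun s hs => ?_
    have hs0 : 0 < s := hs.1
    have h2 : s ^ (-α) = s * s ^ (-α - 1) := by
      rw [← Real.rpow_one_add' hs0.le (by linarith)]; congr 1; ring
    rw [Real.norm_of_nonneg (mul_nonneg (le_min zero_le_two (by positivity)) (by positivity)), h2,
      ← mul_assoc]
    gcongr
    exact min_le_right _ _
  · have h1 : IntegrableOn (fun s : ℝ => 2 * s ^ (-α - 1)) (Set.Ioi 1) :=
      (integrableOn_Ioi_rpow_of_lt (by linarith) one_pos).const_mul 2
    refine Integrable.mono' h1 hmeas.aestronglyMeasurable ?_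
    refine (ae_restrict_mem measurableSet_Ioi).mono fun s hs => ?_
    have hs0 : 0 < s := lt_trans one_pos hs
    rw [Real.norm_of_nonneg (mul_nonneg (le_min zero_le_two (by positivity)) (by positivity))]
    gcongr
    exact min_le_left _ _

/-- The integrand defining the exponent of a one-sided stable law. -/
def subInt (α : ℝ) (r : ℂ) (s : ℝ) : ℂ :=
  (1 - Complex.exp (-(r * s))) * ((s ^ (-α - 1) : ℝ) : ℂ)

lemma measurable_subInt (α : ℝ) (r : ℂ) : Measurable (subInt α r) := by
  unfold subInt; fun_prop

lemma norm_subInt_le (α : ℝ) {r : ℂ} (hr : 0 ≤ r.re) {s : ℝ} (hs : 0 < s) :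
    ‖subInt α r s‖ ≤ min 2 (‖r‖ * s) * s ^ (-α - 1) := by
  unfold subInt
  rw [norm_mul, Complex.norm_real, Real.norm_of_nonneg (by positivity : 0 ≤ s ^ (-α - 1))]
  gcongr
  have := norm_one_sub_cexp_neg_le (w := r * s) (by simpa using mul_nonneg hr hs.le)
  simpa [abs_of_pos hs] using this

lemma integrableOn_subInt {α : ℝ} (hα0 : 0 < α) (hα1 : α < 1) {r : ℂ} (hr : 0 ≤ r.re) :
    IntegrableOn (subInt α r) (Set.Ioi 0) :=
  Integrable.mono' (integrableOn_Ioi_min_mul_rpow hα0 hα1 (norm_nonneg r))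
    (measurable_subInt α r).aestronglyMeasurable
    ((ae_restrict_mem measurableSet_Ioi).mono fun _ hs => norm_subInt_le α hr hs)

lemma integrableOn_exp_neg_mul_rpow {α : ℝ} (hα1 : α < 1) {b : ℝ} (hb : 0 < b) :
    IntegrableOn (fun s : ℝ => Real.exp (-(b * s)) * s ^ (-α)) (Set.Ioi 0) := by
  have h0 : -1 < -α := by linarith
  have := integrableOn_rpow_mul_exp_neg_mul_rpow (s := -α) (p := 1) (b := b) h0 one_pos hb
  refine this.congr_fun (fun s _ => ?_) measurableSet_Ioi
  simp [mul_comm]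

lemma hasDerivAt_integral_subInt {α : ℝ} (hα0 : 0 < α) (hα1 : α < 1) {r : ℂ} (hr : 0 < r.re) :
    HasDerivAt (fun r => ∫ s in Set.Ioi 0, subInt α r s)
      (∫ s in Set.Ioi 0, Complex.exp (-(r * (s : ℝ))) * ((s ^ (-α) : ℝ) : ℂ)) r := by
  refine (hasDerivAt_integral_of_dominated_loc_of_deriv_le (𝕜 := ℂ) (E := ℂ) (F := subInt α)
    (F' := fun z s => Complex.exp (-(z * (s : ℝ))) * ((s ^ (-α) : ℝ) : ℂ)) (bound := fun s : ℝ => Real.exp (-(r.re / 2 * s)) * s ^ (-α))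
    (s := {z : ℂ | r.re / 2 < z.re}) ?_ ?_ ?_ ?_ ?_ ?_ ?_).2
  · exact (isOpen_lt continuous_const Complex.continuous_re).mem_nhds (by simp; linarith)
  · exact Eventually.of_forall fun z => (measurable_subInt α z).aestronglyMeasurable
  · exact integrableOn_subInt hα0 hα1 hr.le
  · exact Measurable.aestronglyMeasurable (by fun_prop)
  · refine (ae_restrict_mem measurableSet_Ioi).mono fun s hs z hz => ?_
    have hs0 : 0 < s := hs
    rw [norm_mul, Complex.norm_real, Real.norm_of_nonneg (by positivity : 0 ≤ s ^ (-α)),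
      Complex.norm_exp]
    gcongr
    have hz' : r.re / 2 < z.re := hz
    simp
    gcongr
  · exact integrableOn_exp_neg_mul_rpow hα1 (by linarith)
  · refine (ae_restrict_mem measurableSet_Ioi).mono fun s hs z hz => ?_
    have hs0 : 0 < s := hs
    have h2 : s ^ (-α) = s * s ^ (-α - 1) := by
      rw [← Real.rpow_one_add' hs0.le (by linarith)]; congr 1; ring
    have h1 : HasDerivAt (fun z : ℂ => -(z * s)) (-(1 * (s : ℂ))) z :=
      ((hasDerivAt_id z).mul_const (s : ℂ)).neg
    have := ((h1.cexp).const_sub 1).mul_const ((s ^ (-α - 1) : ℝ) : ℂ)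
    unfold subInt
    convert! this using 1
    rw [h2]; push_cast; ring

lemma integral_subInt_of_pos {α : ℝ} (hα0 : 0 < α) (hα1 : α < 1) {b : ℝ} (hb : 0 < b) :
    ∫ s in Set.Ioi 0, subInt α b s = ((Real.Gamma (1 - α) / α * b ^ α : ℝ) : ℂ) := by
  have hcast : ∀ s : ℝ, subInt α b s = (((1 - Real.exp (-(b * s))) * s ^ (-α - 1) : ℝ) : ℂ) := by
    intro s; unfold subInt; push_cast; ring
  simp_rw [hcast]
  rw [integral_complex_ofReal]
  congr 1
  have hint1 : IntegrableOn (fun s : ℝ => (1 - Real.exp (-(b * s))) * s ^ (-α - 1))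
      (Set.Ioi 0) := by
    have := (integrableOn_subInt hα0 hα1 (r := b) (by simpa using hb.le)).re
    refine this.congr (ae_of_all _ fun s => ?_)
    simp only [hcast, Complex.ofReal_re, RCLike.re_to_complex]
  have hint2 := integrableOn_exp_neg_mul_rpow hα1 hb
  have hmin : ∀ s : ℝ, 0 < s → |1 - Real.exp (-(b * s))| ≤ min 1 (b * s) := by
    intro s hs
    have h1 : Real.exp (-(b * s)) ≤ 1 := Real.exp_le_one_iff.mpr (by nlinarith)
    rw [abs_of_nonneg (by linarith)]
    refine le_min (by linarith [Real.exp_pos (-(b * s))]) ?_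
    linarith [Real.add_one_le_exp (-(b * s))]
  have key := integral_Ioi_of_hasDerivAt_of_tendsto (a := 0) (m := 0)
    (f := fun s : ℝ => -((1 - Real.exp (-(b * s))) * s ^ (-α)) / α)
    (f' := fun s : ℝ => (1 - Real.exp (-(b * s))) * s ^ (-α - 1) -
      b / α * (Real.exp (-(b * s)) * s ^ (-α))) ?_ ?_ (hint1.sub (hint2.const_mul _)) ?_
  · rw [integral_sub hint1 (hint2.const_mul _), integral_const_mul] at key
    have hG := Real.integral_rpow_mul_exp_neg_mul_Ioi (a := 1 - α) (r := b) (by linarith) hb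
    have hG' : ∫ s in Set.Ioi 0, Real.exp (-(b * s)) * s ^ (-α) =
        (1 / b) ^ (1 - α) * Real.Gamma (1 - α) := by
      rw [← hG]; congr 1; ext s; rw [mul_comm]; congr 2; ring
    rw [hG'] at key
    have h3 : b * (1 / b) ^ (1 - α) = b ^ α := by
      rw [one_div, Real.inv_rpow hb.le, ← Real.rpow_neg hb.le, ← Real.rpow_one_add' hb.le]
      · congr 1; ring
      · ring_nf; exact hα0.ne'
    have h4 : ∫ s in Set.Ioi 0, (1 - Real.exp (-(b * s))) * s ^ (-α - 1) =
        b / α * ((1 / b) ^ (1 - α) * Real.Gamma (1 - α)) := by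
      simp at key ⊢; linarith
    rw [h4, ← h3]; ring
  · have h0 : Tendsto (fun s : ℝ => b / α * s ^ (1 - α)) (𝓝[Set.Ici 0] 0) (𝓝 0) := by
      have : ContinuousAt (fun s : ℝ => b / α * s ^ (1 - α)) 0 :=
        (Real.continuousAt_rpow_const 0 (1 - α) (Or.inr (by linarith))).const_mul _
      have h := this.tendsto
      rw [Real.zero_rpow (by linarith), mul_zero] at h
      exact h.mono_left nhdsWithin_le_nhds
    unfold ContinuousWithinAt
    simp only [mul_zero, neg_zero, Real.exp_zero, sub_self, zero_mul, zero_div]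
    refine squeeze_zero_norm' ?_ h0
    filter_upwards [self_mem_nhdsWithin] with s hs
    rcases eq_or_lt_of_le (show (0 : ℝ) ≤ s from hs) with rfl | hs0
    · simp; positivity
    · have h2 : s ^ (1 - α) = s * s ^ (-α) := by
        rw [← Real.rpow_one_add' hs0.le (by linarith)]; congr 1
      rw [norm_div, norm_neg, norm_mul, Real.norm_of_nonneg hα0.le,
        Real.norm_of_nonneg (by positivity : 0 ≤ s ^ (-α)), h2, Real.norm_eq_abs]
      have := (hmin s hs0).trans (min_le_right _ _)
      calc _ ≤ (b * s) * s ^ (-α) / α := by gcongr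
        _ = _ := by ring
  · intro s hs
    have hs0 : (0 : ℝ) < s := hs
    have h1 : HasDerivAt (fun z : ℝ => -(b * z)) (-(b * 1)) s :=
      ((hasDerivAt_id s).const_mul b).neg
    have := ((((h1.exp).const_sub 1).mul
      (Real.hasDerivAt_rpow_const (p := -α) (Or.inl hs0.ne'))).neg).div_const α
    convert! this using 1
    field_simp
    ring
  · have h0 : Tendsto (fun s : ℝ => s ^ (-α) / α) atTop (𝓝 0) := by
      simpa using (tendsto_rpow_neg_atTop hα0).div_const α
    refine squeeze_zero_norm' ?_ h0
    filter_upwards [eventually_gt_atTop 0] with s hs0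
    rw [norm_div, norm_neg, norm_mul, Real.norm_of_nonneg hα0.le,
      Real.norm_of_nonneg (by positivity : 0 ≤ s ^ (-α)), Real.norm_eq_abs]
    have := (hmin s hs0).trans (min_le_left _ _)
    calc _ ≤ 1 * s ^ (-α) / α := by gcongr
      _ = _ := by ring

lemma integral_subInt_of_re_pos {α : ℝ} (hα0 : 0 < α) (hα1 : α < 1) {r : ℂ} (hr : 0 < r.re) :
    ∫ s in Set.Ioi 0, subInt α r s = ((Real.Gamma (1 - α) / α : ℝ) : ℂ) * r ^ (α : ℂ) := by
  have hopen : IsOpen {z : ℂ | 0 < z.re} := isOpen_lt continuous_const Complex.continuous_re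
  have h1 : AnalyticOnNhd ℂ (fun r => ∫ s in Set.Ioi 0, subInt α r s) {z : ℂ | 0 < z.re} :=
    DifferentiableOn.analyticOnNhd (fun z hz =>
      (hasDerivAt_integral_subInt hα0 hα1 hz).differentiableAt.differentiableWithinAt) hopen
  have h2 : AnalyticOnNhd ℂ (fun r : ℂ => ((Real.Gamma (1 - α) / α : ℝ) : ℂ) * r ^ (α : ℂ))
      {z : ℂ | 0 < z.re} := by
    refine DifferentiableOn.analyticOnNhd (fun z hz => ?_) hopen
    exact (((differentiableAt_id).cpow_const (Or.inl hz)).const_mul _).differentiableWithinAt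
  refine h1.eqOn_of_preconnected_of_frequently_eq h2 (z₀ := 1)
    (convex_halfSpace_re_gt 0).isPreconnected (by simp) ?_ hr
  have ht : Tendsto (fun n : ℕ => ((1 + 1 / ((n : ℝ) + 1) : ℝ) : ℂ)) atTop (𝓝[≠] 1) := by
    refine tendsto_nhdsWithin_iff.mpr ⟨?_, Eventually.of_forall fun n => ?_⟩
    · have := (tendsto_one_div_add_atTop_nhds_zero_nat (𝕜 := ℝ)).const_add 1
      rw [add_zero] at this
      simpa [Function.comp_def] using (Complex.continuous_ofReal.tendsto 1).comp this
    · intro h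
      rw [Set.mem_singleton_iff] at h
      have h' : (1 + 1 / ((n : ℝ) + 1) : ℝ) = 1 := by exact_mod_cast h
      have : (0 : ℝ) < 1 / ((n : ℝ) + 1) := by positivity
      linarith
  refine ht.frequently (Eventually.frequently (Eventually.of_forall fun n => ?_))
  have hp : (0 : ℝ) < 1 + 1 / ((n : ℝ) + 1) := by positivity
  rw [integral_subInt_of_pos hα0 hα1 hp, Complex.ofReal_mul, Complex.ofReal_cpow hp.le]

lemma neg_I_mul_cpow (α : ℝ) {x : ℝ} (hx : x ≠ 0) :
    (-(Complex.I * x)) ^ (α : ℂ) = ((|x| ^ α * Real.cos (π * α / 2) : ℝ) : ℂ) -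
      Complex.I * ((|x| ^ α * Real.sin (π * α / 2) : ℝ) : ℂ) * (Real.sign x : ℂ) := by
  have hne : -(Complex.I * x) ≠ 0 := by simp [hx]
  have hn : ‖-(Complex.I * (x : ℂ))‖ = |x| := by simp
  have harg : (-(Complex.I * (x : ℂ))).arg = -(π / 2 * Real.sign x) := by
    rcases lt_or_gt_of_ne hx with h | h
    · rw [Real.sign_of_neg h]
      have : -(Complex.I * (x : ℂ)) = ((-x : ℝ) : ℂ) * Complex.I := by push_cast; ring
      rw [this, Complex.arg_real_mul _ (by linarith), Complex.arg_I]; ring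
    · rw [Real.sign_of_pos h]
      have : -(Complex.I * (x : ℂ)) = ((x : ℝ) : ℂ) * (-Complex.I) := by ring
      rw [this, Complex.arg_real_mul _ h, Complex.arg_neg_I]; ring
  rw [Complex.cpow_def_of_ne_zero hne, Complex.log, hn, harg]
  have hx' : 0 < |x| := abs_pos.mpr hx
  have : ((Real.log |x| : ℝ) + ((-(π / 2 * Real.sign x) : ℝ) : ℂ) * Complex.I) * (α : ℂ) =
      ((Real.log |x| * α : ℝ) : ℂ) + ((-(π * α / 2 * Real.sign x) : ℝ) : ℂ) * Complex.I := by
    push_cast; ring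
  rw [this, Complex.exp_add, Complex.exp_mul_I, ← Complex.ofReal_cos, ← Complex.ofReal_sin,
    ← Complex.ofReal_exp, ← Real.rpow_def_of_pos hx']
  rcases lt_or_gt_of_ne hx with h | h
  · rw [Real.sign_of_neg h]; simp; ring
  · rw [Real.sign_of_pos h]; simp; ring

/-- `∫₀^∞ (1 - e^{isx}) s^{-α-1} ds`. -/
def stableKernel (α x : ℝ) : ℂ := ∫ s in Set.Ioi 0, subInt α (-(Complex.I * x)) s

lemma stableKernel_eq {α : ℝ} (hα0 : 0 < α) (hα1 : α < 1) (x : ℝ) :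
    stableKernel α x = ((Real.Gamma (1 - α) / α * Real.cos (π * α / 2) : ℝ) : ℂ) *
      (((|x| ^ α : ℝ) : ℂ) * (1 - Complex.I * (Real.tan (π * α / 2) : ℂ) * (Real.sign x : ℂ))) := by
  unfold stableKernel
  rcases eq_or_ne x 0 with rfl | hx
  · simp [subInt, Real.zero_rpow hα0.ne']
  have hcos : Real.cos (π * α / 2) ≠ 0 := by
    refine (Real.cos_pos_of_mem_Ioo ⟨?_, ?_⟩).ne' <;> nlinarith [Real.pi_pos]
  have hre : ∀ n : ℕ, 0 < (((1 / ((n : ℝ) + 1) : ℝ) : ℂ) + -(Complex.I * x)).re := by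
    intro n
    have h0 : (-(Complex.I * (x : ℂ))).re = 0 := by simp
    rw [Complex.add_re, Complex.ofReal_re, h0, add_zero]
    positivity
  have hlim1 : Tendsto (fun n : ℕ => ∫ s in Set.Ioi 0,
      subInt α ((1 / ((n : ℝ) + 1) : ℝ) + -(Complex.I * x)) s) atTop
      (𝓝 (∫ s in Set.Ioi 0, subInt α (-(Complex.I * x)) s)) := by
    refine tendsto_integral_of_dominated_convergence
      (fun s : ℝ => min 2 ((1 + |x|) * s) * s ^ (-α - 1))
      (fun n => (measurable_subInt α _).aestronglyMeasurable)
      (integrableOn_Ioi_min_mul_rpow hα0 hα1 (by positivity)) (fun n => ?_) ?_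
    · refine (ae_restrict_mem measurableSet_Ioi).mono fun s hs => ?_
      have hs0 : (0 : ℝ) < s := hs
      refine (norm_subInt_le α (hre n).le hs).trans ?_
      gcongr
      refine (norm_add_le _ _).trans ?_
      rw [Complex.norm_real, norm_neg, norm_mul, Complex.norm_I, Complex.norm_real, one_mul,
        Real.norm_eq_abs, Real.norm_eq_abs]
      gcongr
      rw [abs_of_nonneg (by positivity), div_le_one (by positivity)]
      linarith [n.cast_nonneg (α := ℝ)]
    · refine ae_of_all _ fun s => ?_
      have hc : Continuous (fun ε : ℝ => subInt α (ε + -(Complex.I * x)) s) := by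
        unfold subInt; fun_prop
      have := (hc.tendsto 0).comp (tendsto_one_div_add_atTop_nhds_zero_nat (𝕜 := ℝ))
      simpa [Function.comp_def] using this
  have hlim2 : Tendsto (fun n : ℕ => ∫ s in Set.Ioi 0,
      subInt α ((1 / ((n : ℝ) + 1) : ℝ) + -(Complex.I * x)) s) atTop
      (𝓝 (((Real.Gamma (1 - α) / α : ℝ) : ℂ) * (-(Complex.I * x)) ^ (α : ℂ))) := by
    simp_rw [fun n => integral_subInt_of_re_pos hα0 hα1 (hre n)]
    refine Tendsto.const_mul _ ?_
    have hc : ContinuousAt (fun z : ℂ => z ^ (α : ℂ)) (-(Complex.I * x)) :=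
      continuousAt_id.cpow continuousAt_const (by right; simpa using hx)
    have ht : Tendsto (fun n : ℕ => ((1 / ((n : ℝ) + 1) : ℝ) : ℂ) + -(Complex.I * x)) atTop
        (𝓝 (-(Complex.I * x))) := by
      have := ((Complex.continuous_ofReal.tendsto 0).comp
        (tendsto_one_div_add_atTop_nhds_zero_nat (𝕜 := ℝ))).add_const (-(Complex.I * (x : ℂ)))
      simpa [Function.comp_def] using this
    exact hc.tendsto.comp ht
  rw [tendsto_nhds_unique hlim1 hlim2, neg_I_mul_cpow α hx, Real.tan_eq_sin_div_cos]
  generalize Real.cos (π * α / 2) = c at hcos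
  generalize Real.sin (π * α / 2) = c'
  have hcos' : (c : ℂ) ≠ 0 := by exact_mod_cast hcos
  push_cast
  field_simp

section SmallJumps

variable {d : ℕ}

/-- The complex number `⟨y, z + ηu⟩`, for a complex shift `η` in the direction `u`. -/
def cpair (u y z : Ed d) (η : ℂ) : ℂ := (⟪y, z⟫ : ℂ) + η * (⟪y, u⟫ : ℂ)

/-- The characteristic exponent of the Lévy measure `N`, at the complex point `z + ηu`. -/
def levyExp (N : Measure (Ed d)) (u z : Ed d) (η : ℂ) : ℂ :=
  ∫ y, (1 - Complex.exp (Complex.I * cpair u y z η)) ∂N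

/-- The derivative of `levyExp` in the complex shift. -/
def levyExpDeriv (N : Measure (Ed d)) (u z : Ed d) (η : ℂ) : ℂ :=
  ∫ y, -(Complex.exp (Complex.I * cpair u y z η) * (Complex.I * (⟪y, u⟫ : ℂ))) ∂N

lemma re_I_mul_cpair (u y z : Ed d) (η : ℂ) :
    (Complex.I * cpair u y z η).re = -(η.im * ⟪y, u⟫) := by
  simp [cpair]

lemma abs_inner_le_of_norm_one {u : Ed d} (hu : ‖u‖ = 1) (y : Ed d) : |⟪y, u⟫| ≤ ‖y‖ := by
  simpa [hu] using abs_real_inner_le_norm y u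

lemma neg_mul_inner_le {u y : Ed d} (hu : ‖u‖ = 1) {ρ B b : ℝ} (hy : ‖y‖ ≤ ρ) (hb : |b| ≤ B) :
    -(b * ⟪y, u⟫) ≤ B * ρ := by
  have h1 := (abs_inner_le_of_norm_one hu y).trans hy
  calc -(b * ⟪y, u⟫) ≤ |b * ⟪y, u⟫| := neg_le_abs _
    _ = |b| * |⟪y, u⟫| := abs_mul _ _
    _ ≤ B * ρ := mul_le_mul hb h1 (abs_nonneg _) ((abs_nonneg _).trans hb)

lemma measurable_cpair_left (u z : Ed d) (η : ℂ) : Measurable (fun y => cpair u y z η) := by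
  unfold cpair; fun_prop

lemma norm_one_sub_cexp_cpair_le {u y : Ed d} (hu : ‖u‖ = 1) {ρ B : ℝ} (hy : ‖y‖ ≤ ρ)
    (z : Ed d) {η : ℂ} (hη : |η.im| ≤ B) :
    ‖1 - Complex.exp (Complex.I * cpair u y z η)‖ ≤ Real.exp (B * ρ) * (‖z‖ + ‖η‖) * ‖y‖ := by
  have hB : 0 ≤ B := (abs_nonneg _).trans hη
  have hρ : 0 ≤ ρ := (norm_nonneg _).trans hy
  have h1 := norm_cexp_sub_cexp_le (B := B * ρ) (a := 0) (b := Complex.I * cpair u y z η)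
    (by simpa using mul_nonneg hB hρ)
    (by rw [re_I_mul_cpair]; exact neg_mul_inner_le hu hy hη)
  rw [Complex.exp_zero, zero_sub, norm_neg, norm_mul, Complex.norm_I, one_mul] at h1
  refine h1.trans ?_
  rw [mul_assoc]
  gcongr
  unfold cpair
  refine (norm_add_le _ _).trans ?_
  rw [norm_mul, Complex.norm_real, Complex.norm_real, add_mul]
  have h2 := abs_real_inner_le_norm y z
  have h3 := abs_inner_le_of_norm_one hu y
  simp only [Real.norm_eq_abs]
  gcongr
  linarith

variable {N : Measure (Ed d)} {ρ : ℝ}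

lemma integrable_levyExp (hN : ∀ᵐ y ∂N, ‖y‖ ≤ ρ) (hint : Integrable (fun y => ‖y‖) N)
    {u : Ed d} (hu : ‖u‖ = 1) (z : Ed d) (η : ℂ) :
    Integrable (fun y => 1 - Complex.exp (Complex.I * cpair u y z η)) N := by
  refine Integrable.mono' (hint.const_mul (Real.exp (|η.im| * ρ) * (‖z‖ + ‖η‖))) ?_ ?_
  · have := measurable_cpair_left u z η
    exact Measurable.aestronglyMeasurable (by fun_prop)
  · exact hN.mono fun y hy => norm_one_sub_cexp_cpair_le hu hy z le_rfl

lemma norm_levyExpDeriv_integrand_le {u y : Ed d} (hu : ‖u‖ = 1) {B : ℝ} (hy : ‖y‖ ≤ ρ)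
    (z : Ed d) {η : ℂ} (hη : |η.im| ≤ B) :
    ‖-(Complex.exp (Complex.I * cpair u y z η) * (Complex.I * (⟪y, u⟫ : ℂ)))‖ ≤
      Real.exp (B * ρ) * ‖y‖ := by
  rw [norm_neg, norm_mul, norm_mul, Complex.norm_I, one_mul, Complex.norm_real, Complex.norm_exp,
    re_I_mul_cpair]
  have h1 := neg_mul_inner_le hu hy hη
  have h2 := abs_inner_le_of_norm_one hu y
  rw [Real.norm_eq_abs]
  gcongr

lemma norm_levyExpDeriv_le (hN : ∀ᵐ y ∂N, ‖y‖ ≤ ρ) (hint : Integrable (fun y => ‖y‖) N)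
    {u : Ed d} (hu : ‖u‖ = 1) (z : Ed d) {B : ℝ} {η : ℂ} (hη : |η.im| ≤ B) :
    ‖levyExpDeriv N u z η‖ ≤ Real.exp (B * ρ) * ∫ y, ‖y‖ ∂N := by
  rw [← integral_const_mul]
  exact norm_integral_le_of_norm_le (hint.const_mul _)
    (hN.mono fun y hy => norm_levyExpDeriv_integrand_le hu hy z hη)

lemma hasDerivAt_levyExp (hN : ∀ᵐ y ∂N, ‖y‖ ≤ ρ) (hint : Integrable (fun y => ‖y‖) N)
    {u : Ed d} (hu : ‖u‖ = 1) (z : Ed d) (η₀ : ℂ) :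
    HasDerivAt (levyExp N u z) (levyExpDeriv N u z η₀) η₀ := by
  refine (hasDerivAt_integral_of_dominated_loc_of_deriv_le (𝕜 := ℂ) (E := ℂ)
    (F := fun η y => 1 - Complex.exp (Complex.I * cpair u y z η))
    (F' := fun η y => -(Complex.exp (Complex.I * cpair u y z η) * (Complex.I * (⟪y, u⟫ : ℂ))))
    (bound := fun y => Real.exp ((|η₀.im| + 1) * ρ) * ‖y‖)
    (s := Metric.ball η₀ 1) (Metric.ball_mem_nhds _ one_pos) ?_ ?_ ?_ ?_ ?_ ?_).2
  · exact Eventually.of_forall fun η => (integrable_levyExp hN hint hu z η).1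
  · exact integrable_levyExp hN hint hu z η₀
  · have := measurable_cpair_left u z η₀
    exact Measurable.aestronglyMeasurable (by fun_prop)
  · refine hN.mono fun y hy η hη => norm_levyExpDeriv_integrand_le hu hy z ?_
    have h1 : |(η - η₀).im| ≤ ‖η - η₀‖ := Complex.abs_im_le_norm _
    rw [Metric.mem_ball, dist_eq_norm] at hη
    have h2 : |η.im| ≤ |η₀.im| + |(η - η₀).im| := by
      have := abs_add_le η₀.im (η - η₀).im
      simpa using this
    linarith
  · exact hint.const_mul _
  · refine ae_of_all _ fun y η _ => ?_
    have h1 : HasDerivAt (fun η => Complex.I * cpair u y z η) (Complex.I * (⟪y, u⟫ : ℂ)) η := by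
      unfold cpair
      simpa using ((((hasDerivAt_id η).mul_const (⟪y, u⟫ : ℂ)).const_add (⟪y, z⟫ : ℂ)).const_mul
        Complex.I)
    exact h1.cexp.const_sub 1

lemma levyExp_zero_re_nonneg (u z : Ed d) : 0 ≤ (levyExp N u z 0).re := by
  by_cases h : Integrable (fun y => 1 - Complex.exp (Complex.I * cpair u y z 0)) N
  · have := integral_re h
    unfold levyExp
    simp only [RCLike.re_to_complex] at this
    rw [← this]
    refine integral_nonneg fun y => ?_
    have h1 := Complex.re_le_norm (Complex.exp (Complex.I * cpair u y z 0))
    rw [Complex.norm_exp, re_I_mul_cpair] at h1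
    simpa using h1
  · simp [levyExp, integral_undef h]

lemma one_sub_exp_ge (q : ℝ) {B : ℝ} (hq : -q ≤ B) (hB : 0 ≤ B) :
    -(|q| * Real.exp B) ≤ 1 - Real.exp (-q) := by
  have h := norm_cexp_sub_cexp_le (B := B) (a := ((-q : ℝ) : ℂ)) (b := 0)
    (by simpa using hq) (by simpa using hB)
  rw [Complex.exp_zero, sub_zero, ← Complex.ofReal_exp, ← Complex.ofReal_one, ← Complex.ofReal_sub,
    Complex.norm_real, Complex.norm_real, Real.norm_eq_abs, Real.norm_eq_abs, abs_neg] at h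
  have := neg_abs_le (1 - Real.exp (-q))
  rw [abs_sub_comm] at this
  linarith

lemma levyExp_re_ge (hN : ∀ᵐ y ∂N, ‖y‖ ≤ ρ) (hint : Integrable (fun y => ‖y‖) N) (hρ : 0 ≤ ρ)
    {u : Ed d} (hu : ‖u‖ = 1) (z : Ed d) {B : ℝ} {η : ℂ} (hη : |η.im| ≤ B) :
    Real.exp (-(B * ρ)) * (levyExp N u (z + η.re • u) 0).re -
      B * Real.exp (B * ρ) * ∫ y, ‖y‖ ∂N ≤ (levyExp N u z η).re := by
  have hB : 0 ≤ B := (abs_nonneg _).trans hη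
  have h1 := integrable_levyExp hN hint hu z η
  have h0 := integrable_levyExp hN hint hu (z + η.re • u) 0
  have e1 := integral_re h1
  have e0 := integral_re h0
  simp only [RCLike.re_to_complex] at e1 e0
  unfold levyExp
  rw [← e1, ← e0, ← integral_const_mul, ← integral_const_mul, ← integral_sub]
  · refine integral_mono_ae ((h0.re.const_mul _).sub (hint.const_mul _)) h1.re ?_
    refine hN.mono fun y hy => ?_
    have hre : ∀ w : ℂ, (1 - Complex.exp (Complex.I * w)).re =
        1 - Real.exp (-w.im) * Real.cos w.re := by
      intro w; simp [Complex.exp_re]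
    have hp0 : cpair u y (z + η.re • u) 0 = ((⟪y, z⟫ + η.re * ⟪y, u⟫ : ℝ) : ℂ) := by
      simp [cpair, inner_add_right, inner_smul_right]
    have hpre : (cpair u y z η).re = ⟪y, z⟫ + η.re * ⟪y, u⟫ := by simp [cpair]
    have hpim : (cpair u y z η).im = η.im * ⟪y, u⟫ := by simp [cpair]
    simp only [hre, hp0, hpre, hpim, Complex.ofReal_re, Complex.ofReal_im,
      neg_zero, Real.exp_zero, one_mul]
    set c := Real.cos (⟪y, z⟫ + η.re * ⟪y, u⟫) with hc
    set q := η.im * ⟪y, u⟫ with hq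
    have hc1 : c ≤ 1 := Real.cos_le_one _
    have hq1 : -q ≤ B * ρ := neg_mul_inner_le hu hy hη
    have hq2 : -(B * ρ) ≤ -q := by
      have := neg_mul_inner_le hu hy (b := -η.im) (by simpa using hη)
      linarith
    have hq3 : |q| ≤ B * ‖y‖ := by
      rw [hq, abs_mul]
      exact mul_le_mul hη (abs_inner_le_of_norm_one hu y) (abs_nonneg _) hB
    have h5 := one_sub_exp_ge q hq1 (mul_nonneg hB hρ)
    have h6 : Real.exp (-(B * ρ)) ≤ Real.exp (-q) := Real.exp_le_exp.mpr hq2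
    have h7 : |q| * Real.exp (B * ρ) ≤ B * ‖y‖ * Real.exp (B * ρ) := by gcongr
    have h8 : Real.exp (-(B * ρ)) * (1 - c) ≤ Real.exp (-q) * (1 - c) := by
      have : 0 ≤ 1 - c := by linarith
      gcongr
    nlinarith
  · exact h0.re.const_mul _
  · exact hint.const_mul _

lemma measurable_levyExp [SFinite N] (u : Ed d) (η : ℂ) :
    StronglyMeasurable (fun z => levyExp N u z η) := by
  unfold levyExp
  refine StronglyMeasurable.integral_prod_right (f := fun z y => _) ?_
  refine Measurable.stronglyMeasurable ?_
  unfold cpair Function.uncurry; fun_prop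

lemma measurable_levyExpDeriv [SFinite N] (u : Ed d) (η : ℂ) :
    StronglyMeasurable (fun z => levyExpDeriv N u z η) := by
  unfold levyExpDeriv
  refine StronglyMeasurable.integral_prod_right (f := fun z y => _) ?_
  refine Measurable.stronglyMeasurable ?_
  unfold cpair Function.uncurry; fun_prop

end SmallJumps

section ContourShift

variable {d : ℕ}

lemma integrable_exp_neg_mul_norm_rpow {α c : ℝ} (hα0 : 0 < α) (hα1 : α < 1) (hc : 0 < c) :
    Integrable (fun z : Ed d => Real.exp (-(c * ‖z‖ ^ α))) := by
  obtain ⟨n, hn⟩ := exists_nat_gt (d / α)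
  have hn' : (d : ℝ) < α * n := by rw [div_lt_iff₀ hα0] at hn; linarith
  have h1 : Integrable (fun z : Ed d => (1 + ‖z‖) ^ (-(α * n))) :=
    integrable_one_add_norm (by simpa using hn')
  refine (h1.const_mul (Real.exp c * (n.factorial / c ^ n))).mono' ?_ (ae_of_all _ fun z => ?_)
  · exact Measurable.aestronglyMeasurable (by fun_prop)
  · rw [Real.norm_eq_abs, Real.abs_exp]
    have hK : 0 < 1 + ‖z‖ := by positivity
    have hX : 0 < (1 + ‖z‖) ^ α := by positivity
    have h2 : (1 + ‖z‖) ^ α ≤ 1 + ‖z‖ ^ α := by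
      simpa using Real.rpow_add_le_add_rpow zero_le_one (norm_nonneg z) hα0.le hα1.le
    have h3 := Real.pow_div_factorial_le_exp (c * (1 + ‖z‖) ^ α) (by positivity) n
    have h4 : Real.exp (-(c * ‖z‖ ^ α)) ≤ Real.exp c * Real.exp (-(c * (1 + ‖z‖) ^ α)) := by
      rw [← Real.exp_add]; gcongr; nlinarith
    refine h4.trans ?_
    rw [mul_assoc]
    gcongr
    rw [Real.exp_neg, Real.rpow_neg hK.le, Real.rpow_mul hK.le, Real.rpow_natCast]
    rw [inv_le_comm₀ (Real.exp_pos _) (by positivity)]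
    refine le_of_eq_of_le ?_ h3
    rw [mul_pow]
    field_simp

lemma integral_exp_neg_mul_norm_rpow {α c : ℝ} (hα0 : 0 < α) (hc : 0 < c) :
    ∫ z : Ed d, Real.exp (-(c * ‖z‖ ^ α)) =
      c ^ (-(d / α)) * ∫ z : Ed d, Real.exp (-‖z‖ ^ α) := by
  have h := Measure.integral_comp_smul (volume : Measure (Ed d))
    (fun z : Ed d => Real.exp (-‖z‖ ^ α)) (c ^ α⁻¹)
  have hp : 0 < c ^ α⁻¹ := by positivity
  have e1 : ∀ z : Ed d, ‖c ^ α⁻¹ • z‖ ^ α = c * ‖z‖ ^ α := by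
    intro z
    rw [norm_smul, Real.norm_of_nonneg hp.le, Real.mul_rpow hp.le (norm_nonneg _),
      ← Real.rpow_mul hc.le, inv_mul_cancel₀ hα0.ne', Real.rpow_one]
  simp only [e1] at h
  rw [h, smul_eq_mul]
  congr 1
  rw [finrank_euclideanSpace_fin, ← Real.rpow_natCast, ← Real.rpow_mul hc.le, abs_of_pos (by positivity),
    ← Real.rpow_neg hc.le]
  congr 1
  field_simp

/-- The shifted Fourier integrand. -/
def shiftInt (N : Measure (Ed d)) (u : Ed d) (t : ℝ) (z : Ed d) (η : ℂ) : ℂ :=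
  Complex.exp (-(Complex.I * ((⟪u, z⟫ : ℂ) + η)) - t * levyExp N u z η)

lemma norm_rpow_sub_le {α : ℝ} (hα0 : 0 < α) (hα1 : α < 1) {u : Ed d} (hu : ‖u‖ = 1) (z : Ed d)
    (a : ℝ) : ‖z‖ ^ α ≤ ‖z + a • u‖ ^ α + |a| ^ α := by
  have h1 : ‖z‖ ≤ ‖z + a • u‖ + |a| := by
    have := norm_sub_le (z + a • u) (a • u)
    rwa [add_sub_cancel_right, norm_smul, hu, mul_one] at this
  exact (Real.rpow_le_rpow (norm_nonneg _) h1 hα0.le).trans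
    (Real.rpow_add_le_add_rpow (norm_nonneg _) (abs_nonneg _) hα0.le hα1.le)

variable {N : Measure (Ed d)} {ρ : ℝ}

lemma norm_shiftInt_le (hN : ∀ᵐ y ∂N, ‖y‖ ≤ ρ) (hint : Integrable (fun y => ‖y‖) N) (hρ : 0 ≤ ρ)
    {u : Ed d} (hu : ‖u‖ = 1) {α c m t : ℝ} (hα0 : 0 < α) (hα1 : α < 1) (hc : 0 ≤ c) (ht : 0 ≤ t)
    (hm : 0 ≤ m)
    (hlow : ∀ z, c * ‖z‖ ^ α - m ≤ (levyExp N u z 0).re) (z : Ed d) {A B : ℝ} {η : ℂ}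
    (hA : |η.re| ≤ A) (hB : |η.im| ≤ B) :
    ‖shiftInt N u t z η‖ ≤
      Real.exp (η.im + t * (B * Real.exp (B * ρ) * ∫ y, ‖y‖ ∂N) + t * (c * A ^ α + m)) *
        Real.exp (-(t * Real.exp (-(B * ρ)) * c * ‖z‖ ^ α)) := by
  have hB0 : 0 ≤ B := (abs_nonneg _).trans hB
  have h1 := levyExp_re_ge hN hint hρ hu z hB
  have h2 := hlow (z + η.re • u)
  have h3 := norm_rpow_sub_le hα0 hα1 hu z η.re
  have h4 : |η.re| ^ α ≤ A ^ α := Real.rpow_le_rpow (abs_nonneg _) hA hα0.le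
  rw [shiftInt, Complex.norm_exp, ← Real.exp_add]
  refine Real.exp_le_exp.mpr ?_
  have e1 : (-(Complex.I * ((⟪u, z⟫ : ℂ) + η)) - t * levyExp N u z η).re =
      η.im - t * (levyExp N u z η).re := by simp
  rw [e1]
  set L := (levyExp N u z η).re
  set L0 := (levyExp N u (z + η.re • u) 0).re
  set E := Real.exp (-(B * ρ)) with hE
  have hE1 : E ≤ 1 := Real.exp_le_one_iff.mpr (by nlinarith)
  have hE0 : 0 < E := Real.exp_pos _
  have h5 : c * ‖z‖ ^ α - (c * A ^ α + m) ≤ L0 := by nlinarith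
  have h6 : E * (c * ‖z‖ ^ α - (c * A ^ α + m)) ≤ E * L0 := by gcongr
  have hA0 : 0 ≤ A := (abs_nonneg _).trans hA
  have h7 : 0 ≤ c * A ^ α + m := by positivity
  have h8 : E * (c * A ^ α + m) ≤ c * A ^ α + m := mul_le_of_le_one_left h7 hE1
  have h9 : E * c * ‖z‖ ^ α - (c * A ^ α + m) - B * Real.exp (B * ρ) * ∫ y, ‖y‖ ∂N ≤ L := by
    linarith
  have := mul_le_mul_of_nonneg_left h9 ht
  linarith

lemma measurable_shiftInt [SFinite N] (u : Ed d) (t : ℝ) (η : ℂ) :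
    Measurable (fun z => shiftInt N u t z η) := by
  have := (measurable_levyExp (N := N) u η).measurable
  unfold shiftInt; fun_prop

lemma integral_shiftInt_eq [SFinite N] (hN : ∀ᵐ y ∂N, ‖y‖ ≤ ρ)
    (hint : Integrable (fun y => ‖y‖) N) (hρ : 0 ≤ ρ)
    {u : Ed d} (hu : ‖u‖ = 1) {α c m t : ℝ} (hα0 : 0 < α) (hα1 : α < 1) (hc : 0 < c) (ht : 0 < t)
    (hm : 0 ≤ m)
    (hlow : ∀ z, c * ‖z‖ ^ α - m ≤ (levyExp N u z 0).re) (η : ℂ) :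
    ∫ z, shiftInt N u t z η = ∫ z, shiftInt N u t z 0 := by
  have hbound : ∀ (A B : ℝ), Integrable (fun z : Ed d =>
      Real.exp (-(t * Real.exp (-(B * ρ)) * c * ‖z‖ ^ α))) := fun A B =>
    integrable_exp_neg_mul_norm_rpow hα0 hα1 (by positivity)
  have hI : ∀ η : ℂ, Integrable (fun z => shiftInt N u t z η) := fun η =>
    ((hbound |η.re| |η.im|).const_mul _).mono' (measurable_shiftInt u t η).aestronglyMeasurable
      (ae_of_all _ fun z => norm_shiftInt_le hN hint hρ hu hα0 hα1 hc.le ht.le hm hlow z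
        le_rfl le_rfl)
  have hdiff : Differentiable ℂ (fun η : ℂ => ∫ z, shiftInt N u t z η) := by
    intro η₀
    set A := |η₀.re| + 1
    set B := |η₀.im| + 1
    have hball : ∀ η ∈ Metric.ball η₀ 1, |η.re| ≤ A ∧ |η.im| ≤ B := by
      intro η hη
      rw [Metric.mem_ball, dist_eq_norm] at hη
      have h1 := (Complex.abs_im_le_norm (η - η₀)).trans hη.le
      have h2 := (Complex.abs_re_le_norm (η - η₀)).trans hη.le
      have h3 := abs_add_le η₀.im (η - η₀).im
      have h4 := abs_add_le η₀.re (η - η₀).re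
      simp only [Complex.sub_re, Complex.sub_im, add_sub_cancel] at h1 h2 h3 h4
      exact ⟨h4.trans (by linarith), h3.trans (by linarith)⟩
    refine (hasDerivAt_integral_of_dominated_loc_of_deriv_le (𝕜 := ℂ) (E := ℂ)
      (F := fun η z => shiftInt N u t z η)
      (F' := fun η z => shiftInt N u t z η * (-Complex.I - t * levyExpDeriv N u z η))
      (bound := fun z => Real.exp (B + t * (B * Real.exp (B * ρ) * ∫ y, ‖y‖ ∂N) +
        t * (c * A ^ α + m)) * Real.exp (-(t * Real.exp (-(B * ρ)) * c * ‖z‖ ^ α)) *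
        (1 + t * (Real.exp (B * ρ) * ∫ y, ‖y‖ ∂N)))
      (s := Metric.ball η₀ 1) (Metric.ball_mem_nhds _ one_pos) ?_ ?_ ?_ ?_ ?_
        ?_).2.differentiableAt
    · exact Eventually.of_forall fun η => (hI η).1
    · exact hI η₀
    · have h1 := measurable_shiftInt (N := N) u t η₀
      have h2 := (measurable_levyExpDeriv (N := N) u η₀).measurable
      exact Measurable.aestronglyMeasurable (by fun_prop)
    · refine ae_of_all _ fun z η hη => ?_
      obtain ⟨h1, h2⟩ := hball η hη
      rw [norm_mul]
      have h3 := norm_shiftInt_le hN hint hρ hu hα0 hα1 hc.le ht.le hm hlow z h1 h2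
      have h4 := norm_levyExpDeriv_le hN hint hu z h2
      have h5 : η.im ≤ B := (le_abs_self _).trans h2
      gcongr
      · exact h3.trans (by gcongr)
      · refine (norm_sub_le _ _).trans ?_
        rw [norm_neg, Complex.norm_I, norm_mul, Complex.norm_real, Real.norm_of_nonneg ht.le]
        gcongr
    · exact ((hbound A B).const_mul _).mul_const _
    · refine ae_of_all _ fun z η _ => ?_
      have h1 := hasDerivAt_levyExp hN hint hu z η
      have h2 := (((((hasDerivAt_id η).const_add (⟪u, z⟫ : ℂ)).const_mul Complex.I).neg).sub
        (h1.const_mul (t : ℂ))).cexp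
      simpa [shiftInt] using h2
  have hreal : ∀ a : ℝ, ∫ z, shiftInt N u t z (a : ℂ) = ∫ z, shiftInt N u t z 0 := by
    intro a
    rw [← integral_add_right_eq_self (fun z => shiftInt N u t z 0) (a • u)]
    congr 1
    funext z
    have e2 : levyExp N u z (a : ℂ) = levyExp N u (z + a • u) 0 := by
      unfold levyExp cpair
      simp [inner_add_right, inner_smul_right]
    have e1 : (⟪u, z + a • u⟫ : ℝ) = ⟪u, z⟫ + a := by
      simp [inner_add_right, inner_smul_right, hu]
    unfold shiftInt
    rw [e1, e2]
    simp
  have han : AnalyticOnNhd ℂ (fun η : ℂ => ∫ z, shiftInt N u t z η) Set.univ :=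
    (Complex.analyticOnNhd_univ_iff_differentiable).mpr hdiff
  refine han.eqOn_of_preconnected_of_frequently_eq (g := fun _ => ∫ z, shiftInt N u t z 0)
    analyticOnNhd_const isPreconnected_univ (Set.mem_univ (0 : ℂ)) ?_ (Set.mem_univ η)
  have hmap : Tendsto (fun n : ℕ => (((1 / ((n : ℝ) + 1) : ℝ)) : ℂ)) atTop (𝓝[≠] (0 : ℂ)) := by
    refine tendsto_nhdsWithin_of_tendsto_nhds_of_eventually_within _ ?_ ?_
    · have := (Complex.continuous_ofReal.tendsto 0).comp
        (tendsto_one_div_add_atTop_nhds_zero_nat (𝕜 := ℝ))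
      simpa [Function.comp_def] using this
    · refine Eventually.of_forall fun n => ?_
      have : ((n : ℝ) + 1) ≠ 0 := by positivity
      simp only [Set.mem_compl_iff, Set.mem_singleton_iff]
      exact_mod_cast one_div_ne_zero this
  exact hmap.frequently (Frequently.of_forall fun n => hreal _)

end ContourShift

section SmallJumpDecay

variable {d : ℕ} {N : Measure (Ed d)} {ρ : ℝ}

lemma exists_norm_integral_shiftInt_le [SFinite N] (hN : ∀ᵐ y ∂N, ‖y‖ ≤ ρ)
    (hint : Integrable (fun y => ‖y‖) N)
    {α c m : ℝ} (hα0 : 0 < α) (hα1 : α < 1) (hc : 0 < c) (hm : 0 ≤ m)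
    (hρ : ρ = 1 / (4 + 3 * d / α))
    (hlow : ∀ u z, c * ‖z‖ ^ α - m ≤ (levyExp N u z 0).re) :
    ∃ C, ∀ t, 0 < t → t ≤ 1 → ∀ u : Ed d, ‖u‖ = 1 →
      ‖∫ z, shiftInt N u t z 0‖ ≤ C * t ^ 2 := by
  have hρ0 : 0 < ρ := by rw [hρ]; positivity
  set M := ∫ y, ‖y‖ ∂N with hM
  have hM0 : 0 ≤ M := integral_nonneg fun _ => norm_nonneg _
  set J := ∫ z : Ed d, Real.exp (-‖z‖ ^ α) with hJ
  have hJ0 : 0 ≤ J := integral_nonneg fun _ => (Real.exp_pos _).le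
  refine ⟨Real.exp (1 / ρ * M + m) * (c ^ (-(d / α)) * J), fun t ht ht1 u hu => ?_⟩
  have hlog : Real.log t ≤ 0 := Real.log_nonpos ht.le ht1
  set θ := -(Real.log t) / (2 * ρ) with hθ
  have hθ0 : 0 ≤ θ := by rw [hθ]; apply div_nonneg <;> linarith
  have hexp : Real.exp (θ * ρ) = t ^ (-(1 / 2) : ℝ) := by
    rw [Real.rpow_def_of_pos ht, hθ]
    congr 1
    field_simp
  have hexp' : Real.exp (-(θ * ρ)) = t ^ ((1 / 2) : ℝ) := by
    rw [Real.exp_neg, hexp, ← Real.rpow_neg ht.le, neg_neg]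
  have hexpθ : Real.exp (-θ) = t ^ (1 / (2 * ρ)) := by
    rw [Real.rpow_def_of_pos ht, hθ]
    congr 1
    field_simp
  have hsq : t * t ^ (-(1 / 2) : ℝ) * t ^ (-(1 / 2) : ℝ) = 1 := by
    rw [mul_assoc, ← Real.rpow_add ht]
    norm_num
    rw [Real.rpow_neg_one, mul_inv_cancel₀ ht.ne']
  have hB : t * (θ * Real.exp (θ * ρ)) ≤ 1 / ρ := by
    have h1 : θ * ρ ≤ Real.exp (θ * ρ) := by linarith [Real.add_one_le_exp (θ * ρ)]
    rw [le_div_iff₀ hρ0]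
    calc t * (θ * Real.exp (θ * ρ)) * ρ = t * (θ * ρ) * Real.exp (θ * ρ) := by ring
      _ ≤ t * Real.exp (θ * ρ) * Real.exp (θ * ρ) := by gcongr
      _ = 1 := by rw [hexp, hsq]
  have hb := fun z => norm_shiftInt_le hN hint hρ0.le hu hα0 hα1 hc.le ht.le hm (hlow u) z
    (A := 0) (B := θ) (η := -(θ * Complex.I)) (by simp) (by simp [abs_of_nonneg hθ0])
  rw [← integral_shiftInt_eq hN hint hρ0.le hu hα0 hα1 hc ht hm (hlow u) (-(θ * Complex.I))]
  have hpos : 0 < t * Real.exp (-(θ * ρ)) * c := by positivity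
  refine (norm_integral_le_of_norm_le
    ((integrable_exp_neg_mul_norm_rpow hα0 hα1 hpos).const_mul _) (ae_of_all _ hb)).trans ?_
  rw [integral_const_mul, integral_exp_neg_mul_norm_rpow hα0 hpos, Real.zero_rpow hα0.ne']
  have him : (-((θ : ℂ) * Complex.I)).im = -θ := by simp
  rw [him, ← hM, ← hJ]
  have h1 : Real.exp (-θ + t * (θ * Real.exp (θ * ρ) * M) + t * (c * 0 + m)) ≤
      t ^ (1 / (2 * ρ)) * Real.exp (1 / ρ * M + m) := by
    rw [← hexpθ, ← Real.exp_add]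
    refine Real.exp_le_exp.mpr ?_
    have := mul_le_mul_of_nonneg_right hB hM0
    nlinarith
  have h2 : (t * Real.exp (-(θ * ρ)) * c) ^ (-(d / α)) =
      t ^ (-(3 / 2 * (d / α))) * c ^ (-(d / α)) := by
    rw [Real.mul_rpow (by positivity) hc.le, hexp']
    congr 1
    nth_rewrite 1 [← Real.rpow_one t]
    rw [← Real.rpow_add ht, ← Real.rpow_mul ht.le]
    congr 1; ring
  have h3 : t ^ (1 / (2 * ρ)) * t ^ (-(3 / 2 * (d / α))) = t ^ 2 := by
    rw [← Real.rpow_add ht, ← Real.rpow_natCast]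
    congr 1
    rw [hρ]
    field_simp
    push_cast
    ring
  rw [h2]
  calc _ ≤ t ^ (1 / (2 * ρ)) * Real.exp (1 / ρ * M + m) *
        (t ^ (-(3 / 2 * (d / α))) * c ^ (-(d / α)) * J) := by gcongr
    _ = Real.exp (1 / ρ * M + m) * (c ^ (-(d / α)) * J) *
        (t ^ (1 / (2 * ρ)) * t ^ (-(3 / 2 * (d / α)))) := by ring
    _ = _ := by rw [h3]

end SmallJumpDecay

section LargeJumps

open scoped FourierTransform SchwartzMap ContDiff

variable {d : ℕ}

/-- The Fourier transform of a function `φ`, with the convention of characteristic functions. -/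
def charFT (φ : Ed d → ℝ) (z : Ed d) : ℂ := ∫ w, Complex.exp (Complex.I * (⟪w, z⟫ : ℂ)) * (φ w : ℂ)

lemma exists_schwartz_charFT {φ : Ed d → ℝ} (hφ : ContDiff ℝ ∞ φ) (hsupp : HasCompactSupport φ) :
    ∃ f : 𝓢(Ed d, ℂ), (∀ w, f w = φ w) ∧
      ∀ z, charFT φ z = (𝓕⁻ f) ((2 * π)⁻¹ • z) := by
  have h1 : HasCompactSupport (fun w => (φ w : ℂ)) := hsupp.comp_left Complex.ofReal_zero
  have h2 : ContDiff ℝ ∞ (fun w => (φ w : ℂ)) := Complex.ofRealCLM.contDiff.comp hφ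
  refine ⟨h1.toSchwartzMap h2, fun w => rfl, fun z => ?_⟩
  rw [SchwartzMap.fourierInv_coe, Real.fourierInv_eq']
  unfold charFT
  congr 1
  funext w
  rw [smul_eq_mul, inner_smul_right]
  congr 2
  rw [← mul_assoc, mul_inv_cancel₀ (by positivity), one_mul, mul_comm]

lemma continuous_charFT {φ : Ed d → ℝ} (hφ : ContDiff ℝ ∞ φ) (hsupp : HasCompactSupport φ) :
    Continuous (charFT φ) := by
  obtain ⟨f, -, hf⟩ := exists_schwartz_charFT hφ hsupp
  rw [show charFT φ = fun z => (𝓕⁻ f) ((2 * π)⁻¹ • z) from funext hf]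
  exact (𝓕⁻ f).continuous.comp (by fun_prop)

lemma integrable_pow_mul_charFT {φ : Ed d → ℝ} (hφ : ContDiff ℝ ∞ φ)
    (hsupp : HasCompactSupport φ) (k : ℕ) : Integrable (fun z => ‖z‖ ^ k * ‖charFT φ z‖) := by
  obtain ⟨f, -, hf⟩ := exists_schwartz_charFT hφ hsupp
  have h := (SchwartzMap.integrable_pow_mul volume (𝓕⁻ f) k).comp_smul (R := (2 * π)⁻¹)
    (by positivity)
  simp only [← hf] at h
  refine (h.const_mul ((2 * π) ^ k)).congr (ae_of_all _ fun z => ?_)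
  simp only
  rw [norm_smul, mul_pow ‖(2 * π)⁻¹‖, Real.norm_of_nonneg (by positivity), inv_pow, ← mul_assoc,
    ← mul_assoc, mul_inv_cancel₀ (by positivity), one_mul]

lemma integral_exp_neg_mul_charFT {φ : Ed d → ℝ} (hφ : ContDiff ℝ ∞ φ)
    (hsupp : HasCompactSupport φ) (x : Ed d) :
    ∫ z, Complex.exp (-(Complex.I * (⟪x, z⟫ : ℂ))) * charFT φ z = ((2 * π) ^ d : ℝ) * (φ x : ℂ) := by
  obtain ⟨f, hfφ, hf⟩ := exists_schwartz_charFT hφ hsupp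
  have h1 : 𝓕 (𝓕⁻ f) x = f x := by rw [FourierTransform.fourier_fourierInv_eq]
  rw [SchwartzMap.fourier_coe, Real.fourier_eq'] at h1
  rw [← hfφ, ← h1]
  have h := Measure.integral_comp_smul (volume : Measure (Ed d))
    (fun v : Ed d => Complex.exp (((-2 * π * ⟪v, x⟫ : ℝ) : ℂ) * Complex.I) • (𝓕⁻ f) v) ((2 * π)⁻¹)
  rw [finrank_euclideanSpace_fin, abs_of_pos (by positivity), inv_pow, inv_inv,
    Complex.real_smul] at h
  rw [← h]
  congr 1
  funext z
  rw [hf, smul_eq_mul, inner_smul_left]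
  congr 2
  rw [real_inner_comm]
  have : (π : ℂ) ≠ 0 := by exact_mod_cast Real.pi_ne_zero
  push_cast
  simp only [conj_trivial]
  push_cast
  field_simp

lemma norm_charFT_le (φ : Ed d → ℝ) (z : Ed d) : ‖charFT φ z‖ ≤ ∫ w, |φ w| := by
  refine (norm_integral_le_integral_norm _).trans_eq ?_
  congr 1
  funext w
  rw [norm_mul, mul_comm Complex.I, Complex.norm_exp_ofReal_mul_I, one_mul, Complex.norm_real,
    Real.norm_eq_abs]

/-- The Fourier transform of the large jumps: the part `s > r` of the polar decomposition. -/
def largeFT (φ : Ed d → ℝ) (α r : ℝ) (z : Ed d) : ℂ :=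
  ∫ s in Set.Ioi r, charFT φ (s • z) * ((s ^ (-α - 1) : ℝ) : ℂ)

lemma integrableOn_rpow_neg {β r : ℝ} (hβ : 0 < β) (hr : 0 < r) :
    IntegrableOn (fun s : ℝ => s ^ (-β - 1)) (Set.Ioi r) :=
  integrableOn_Ioi_rpow_of_lt (by linarith) hr

lemma measurable_largeFT_integrand {φ : Ed d → ℝ} (hφ : ContDiff ℝ ∞ φ)
    (hsupp : HasCompactSupport φ) (α : ℝ) :
    Measurable (fun q : Ed d × ℝ => charFT φ (q.2 • q.1) * ((q.2 ^ (-α - 1) : ℝ) : ℂ)) := by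
  have := (continuous_charFT hφ hsupp).measurable
  fun_prop

lemma norm_largeFT_le (φ : Ed d → ℝ) {α r : ℝ} (hα0 : 0 < α) (hr : 0 < r) (z : Ed d) :
    ‖largeFT φ α r z‖ ≤ (∫ w, |φ w|) * ∫ s in Set.Ioi r, s ^ (-α - 1) := by
  rw [← integral_const_mul]
  refine norm_integral_le_of_norm_le ((integrableOn_rpow_neg hα0 hr).const_mul _) ?_
  refine (ae_restrict_iff' measurableSet_Ioi).mpr (ae_of_all _ fun s hs => ?_)
  have hs0 : 0 < s := hr.trans hs
  rw [norm_mul, Complex.norm_real, Real.norm_of_nonneg (by positivity)]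
  gcongr
  exact norm_charFT_le _ _

lemma integrable_largeFT_prod {φ : Ed d → ℝ} (hφ : ContDiff ℝ ∞ φ)
    (hsupp : HasCompactSupport φ) {α r : ℝ} (hα0 : 0 < α) (hr : 0 < r) (k : ℕ) :
    Integrable (fun q : Ed d × ℝ => (‖q.1‖ ^ k : ℂ) *
      (charFT φ (q.2 • q.1) * ((q.2 ^ (-α - 1) : ℝ) : ℂ)))
      ((volume : Measure (Ed d)).prod (volume.restrict (Set.Ioi r))) := by
  have hmeas := measurable_largeFT_integrand hφ hsupp α
  have hcont := (continuous_charFT hφ hsupp).measurable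
  have hI := integrable_pow_mul_charFT hφ hsupp k
  rw [integrable_prod_iff' (Measurable.aestronglyMeasurable (by fun_prop))]
  have hnorm : ∀ s : ℝ, 0 < s → ∀ z : Ed d, ‖(‖z‖ ^ k : ℂ) * (charFT φ (s • z) *
      ((s ^ (-α - 1) : ℝ) : ℂ))‖ = s ^ (-α - 1) * (s ^ k)⁻¹ * (‖s • z‖ ^ k * ‖charFT φ (s • z)‖) := by
    intro s hs z
    rw [norm_mul, norm_mul, Complex.norm_real, Real.norm_of_nonneg (by positivity), norm_pow,
      Complex.norm_real, norm_norm, norm_smul, mul_pow, Real.norm_of_nonneg hs.le]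
    field_simp
  constructor
  · refine (ae_restrict_iff' measurableSet_Ioi).mpr (ae_of_all _ fun s hs => ?_)
    have hs0 : 0 < s := hr.trans hs
    rw [← integrable_norm_iff (Measurable.aestronglyMeasurable (by fun_prop))]
    simp only [hnorm s hs0]
    exact (hI.comp_smul hs0.ne').const_mul _
  · have h1 : IntegrableOn (fun s : ℝ => s ^ (-(α + k + d) - 1) * ∫ z, ‖z‖ ^ k * ‖charFT φ z‖)
        (Set.Ioi r) := (integrableOn_rpow_neg (by positivity) hr).mul_const _
    refine h1.congr ?_
    refine (ae_restrict_iff' measurableSet_Ioi).mpr (ae_of_all _ fun s hs => ?_)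
    have hs0 : 0 < s := hr.trans hs
    simp only [hnorm s hs0]
    rw [integral_const_mul, Measure.integral_comp_smul volume
      (fun z => ‖z‖ ^ k * ‖charFT φ z‖) s, finrank_euclideanSpace_fin, abs_of_pos (by positivity),
      smul_eq_mul, ← mul_assoc]
    congr 1
    rw [← Real.rpow_natCast, ← Real.rpow_natCast, ← Real.rpow_neg hs0.le, ← Real.rpow_neg hs0.le,
      ← Real.rpow_add hs0, ← Real.rpow_add hs0]
    congr 1
    ring

lemma integrable_pow_mul_largeFT {φ : Ed d → ℝ} (hφ : ContDiff ℝ ∞ φ)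
    (hsupp : HasCompactSupport φ) {α r : ℝ} (hα0 : 0 < α) (hr : 0 < r) (k : ℕ) :
    Integrable (fun z => ‖z‖ ^ k * ‖largeFT φ α r z‖) := by
  have h := (integrable_largeFT_prod hφ hsupp hα0 hr k).integral_prod_left.norm
  refine h.congr (ae_of_all _ fun z => ?_)
  simp only
  rw [integral_const_mul, norm_mul, norm_pow, Complex.norm_real, norm_norm]
  rfl

lemma aestronglyMeasurable_largeFT {φ : Ed d → ℝ} (hφ : ContDiff ℝ ∞ φ)
    (hsupp : HasCompactSupport φ) {α r : ℝ} (hα0 : 0 < α) (hr : 0 < r) :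
    AEStronglyMeasurable (largeFT φ α r) := by
  have h := (integrable_largeFT_prod hφ hsupp hα0 hr 0).integral_prod_left.1
  simp only [pow_zero, one_mul] at h
  exact h

lemma integral_exp_neg_mul_largeFT {φ : Ed d → ℝ} (hφ : ContDiff ℝ ∞ φ)
    (hsupp : HasCompactSupport φ) {α r : ℝ} (hα0 : 0 < α) (hr : 0 < r) (u : Ed d) :
    ∫ z, Complex.exp (-(Complex.I * (⟪u, z⟫ : ℂ))) * largeFT φ α r z =
      ((2 * π) ^ d : ℝ) * ((∫ s in Set.Ioi r, φ (s⁻¹ • u) * s ^ (-α - 1 - d) : ℝ) : ℂ) := by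
  have h := integrable_largeFT_prod hφ hsupp hα0 hr 0
  simp only [pow_zero, one_mul] at h
  have h2 : Integrable (Function.uncurry fun (z : Ed d) (s : ℝ) =>
      Complex.exp (-(Complex.I * (⟪u, z⟫ : ℂ))) *
        (charFT φ (s • z) * ((s ^ (-α - 1) : ℝ) : ℂ)))
      ((volume : Measure (Ed d)).prod (volume.restrict (Set.Ioi r))) := by
    refine h.mono (Measurable.aestronglyMeasurable ?_) (ae_of_all _ fun q => ?_)
    · have := measurable_largeFT_integrand hφ hsupp α
      unfold Function.uncurry
      fun_prop
    · simp only [Function.uncurry]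
      rw [norm_mul, ← mul_neg, mul_comm Complex.I, ← Complex.ofReal_neg,
        Complex.norm_exp_ofReal_mul_I, one_mul]
  unfold largeFT
  simp only [← integral_const_mul]
  rw [integral_integral_swap h2, ← integral_complex_ofReal, ← integral_const_mul]
  refine setIntegral_congr_fun measurableSet_Ioi fun s hs => ?_
  have hs0 : 0 < s := hr.trans hs
  have e : ∀ z : Ed d, Complex.exp (-(Complex.I * (⟪u, z⟫ : ℂ))) *
      (charFT φ (s • z) * ((s ^ (-α - 1) : ℝ) : ℂ)) = ((s ^ (-α - 1) : ℝ) : ℂ) *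
      (fun z' => Complex.exp (-(Complex.I * (⟪s⁻¹ • u, z'⟫ : ℂ))) * charFT φ z') (s • z) := by
    intro z
    simp only
    rw [inner_smul_left, inner_smul_right]
    simp only [conj_trivial]
    rw [← mul_assoc s⁻¹, inv_mul_cancel₀ hs0.ne', one_mul]
    ring
  simp only [e]
  rw [integral_const_mul, Measure.integral_comp_smul volume
    (fun z' => Complex.exp (-(Complex.I * (⟪s⁻¹ • u, z'⟫ : ℂ))) * charFT φ z') s, integral_exp_neg_mul_charFT hφ hsupp,
    finrank_euclideanSpace_fin, abs_of_pos (by positivity), Complex.real_smul]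
  have e3 : s ^ (-α - 1 - d) = s ^ (-α - 1) * (s ^ d)⁻¹ := by
    rw [Real.rpow_sub hs0, Real.rpow_natCast, div_eq_mul_inv]
  rw [e3]
  push_cast
  ring

end LargeJumps

section Expansion

variable {d : ℕ} {N : Measure (Ed d)} {ρ : ℝ}

lemma levyExp_zero_shift (u u' z : Ed d) : levyExp N u z 0 = levyExp N u' z 0 := by
  simp [levyExp, cpair]

lemma norm_levyExp_zero_le (hN : ∀ᵐ y ∂N, ‖y‖ ≤ ρ) (hint : Integrable (fun y => ‖y‖) N)
    {u : Ed d} (hu : ‖u‖ = 1) (z : Ed d) : ‖levyExp N u z 0‖ ≤ ‖z‖ * ∫ y, ‖y‖ ∂N := by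
  rw [← integral_const_mul]
  refine norm_integral_le_of_norm_le (hint.const_mul _) (hN.mono fun y hy => ?_)
  simpa using norm_one_sub_cexp_cpair_le hu hy z (η := 0) (B := 0) (by simp)

lemma norm_expansion_remainder_le {t q m m' K : ℝ} (ht0 : 0 ≤ t) (ht1 : t ≤ 1) (hm : 0 ≤ m)
    (hq : q = Real.exp (-(t * m))) {Ψ h : ℂ} (hΨ0 : 0 ≤ Ψ.re) (hΨ : ‖Ψ‖ ≤ K)
    (hh : ‖h‖ ≤ m') :
    ‖q * Complex.exp (-(t * Ψ)) * (Complex.exp (t * h) - 1 - t * h) +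
      t * h * (q * Complex.exp (-(t * Ψ)) - 1)‖ ≤
      t ^ 2 * (m' * Real.exp m' * ‖h‖ + ‖h‖ * (K + m)) := by
  have hm' : 0 ≤ m' := (norm_nonneg _).trans hh
  have hq0 : 0 ≤ q := by rw [hq]; positivity
  have hq1 : q ≤ 1 := by rw [hq]; exact Real.exp_le_one_iff.mpr (by nlinarith)
  have hq2 : 1 - q ≤ t * m := by
    have := Real.add_one_le_exp (-(t * m)); rw [hq]; linarith
  have hre : 0 ≤ (t * Ψ).re := by simpa using mul_nonneg ht0 hΨ0
  set E := Complex.exp (-(t * Ψ)) with hE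
  have hE1 : ‖E‖ ≤ 1 := by
    rw [hE, Complex.norm_exp]; exact Real.exp_le_one_iff.mpr (by simpa using hre)
  have hE2 : ‖1 - E‖ ≤ t * K := by
    refine ((norm_one_sub_cexp_neg_le hre).trans (min_le_right _ _)).trans ?_
    rw [norm_mul, Complex.norm_real, Real.norm_of_nonneg ht0]
    gcongr
  have h1 : ‖Complex.exp (t * h) - 1 - t * h‖ ≤ t ^ 2 * (m' * Real.exp m' * ‖h‖) := by
    have h2 := Complex.norm_exp_sub_sum_le_norm_mul_exp (t * h) 2
    simp only [Finset.sum_range_succ, Finset.sum_range_zero, pow_zero, pow_one, Nat.factorial,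
      Nat.cast_one, div_one, zero_add, mul_one, ← sub_sub] at h2
    refine h2.trans ?_
    have h3 : ‖(t : ℂ) * h‖ = t * ‖h‖ := by
      rw [norm_mul, Complex.norm_real, Real.norm_of_nonneg ht0]
    have h4 : t * ‖h‖ ≤ m' := (mul_le_of_le_one_left (norm_nonneg _) ht1).trans hh
    rw [h3]
    calc (t * ‖h‖) ^ 2 * Real.exp (t * ‖h‖) = t ^ 2 * (‖h‖ * Real.exp (t * ‖h‖) * ‖h‖) := by ring
      _ ≤ t ^ 2 * (m' * Real.exp m' * ‖h‖) := by gcongr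
  have h5 : ‖(q : ℂ) * E - 1‖ ≤ t * (K + m) := by
    have e : (q : ℂ) * E - 1 = -(q * (1 - E)) - ((1 - q : ℝ) : ℂ) := by push_cast; ring
    rw [e]
    refine (norm_sub_le _ _).trans ?_
    rw [norm_neg, norm_mul, Complex.norm_real, Complex.norm_real, Real.norm_of_nonneg hq0,
      Real.norm_of_nonneg (by linarith)]
    have := mul_le_mul hq1 hE2 (norm_nonneg _) zero_le_one
    linarith
  refine (norm_add_le _ _).trans ?_
  rw [norm_mul, norm_mul, norm_mul, norm_mul, Complex.norm_real, Complex.norm_real,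
    Real.norm_of_nonneg hq0, Real.norm_of_nonneg ht0]
  have h6 : q * ‖E‖ ≤ 1 := by simpa using mul_le_mul hq1 hE1 (norm_nonneg _) zero_le_one
  have h7 := mul_le_mul h6 h1 (norm_nonneg _) zero_le_one
  have h8 : t * ‖h‖ * ‖(q : ℂ) * E - 1‖ ≤ t * ‖h‖ * (t * (K + m)) := by gcongr
  linarith

lemma integrable_shiftInt_zero [SFinite N] (hN : ∀ᵐ y ∂N, ‖y‖ ≤ ρ)
    (hint : Integrable (fun y => ‖y‖) N) (hρ : 0 ≤ ρ)
    {u : Ed d} (hu : ‖u‖ = 1) {α c m t : ℝ} (hα0 : 0 < α) (hα1 : α < 1) (hc : 0 < c) (ht : 0 < t)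
    (hm : 0 ≤ m) (hlow : ∀ z, c * ‖z‖ ^ α - m ≤ (levyExp N u z 0).re) :
    Integrable (fun z => shiftInt N u t z 0) :=
  ((integrable_exp_neg_mul_norm_rpow hα0 hα1 (c := t * Real.exp (-(0 * ρ)) * c)
    (by positivity)).const_mul _).mono' (measurable_shiftInt u t 0).aestronglyMeasurable
      (ae_of_all _ fun z => norm_shiftInt_le hN hint hρ hu hα0 hα1 hc.le ht.le hm hlow z
        (A := 0) (B := 0) (by simp) (by simp))

theorem exists_norm_integral_sub_le [SFinite N] (hN : ∀ᵐ y ∂N, ‖y‖ ≤ ρ)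
    (hint : Integrable (fun y => ‖y‖) N)
    {α c m m₀ m' : ℝ} (hα0 : 0 < α) (hα1 : α < 1) (hc : 0 < c) (hm : 0 ≤ m) (hm₀ : 0 ≤ m₀)
    (hρ : ρ = 1 / (4 + 3 * d / α))
    (hlow : ∀ u z, c * ‖z‖ ^ α - m ≤ (levyExp N u z 0).re)
    {h Φ : Ed d → ℂ} (hmeas : AEStronglyMeasurable h) (hbd : ∀ z, ‖h z‖ ≤ m')
    (hI0 : Integrable (fun z => ‖h z‖)) (hI1 : Integrable (fun z => ‖z‖ * ‖h z‖))
    (hΦ : ∀ z, Φ z = levyExp N 0 z 0 + m₀ - h z) :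
    ∃ C : ℝ, ∀ t : ℝ, 0 < t → t ≤ 1 → ∀ u : Ed d, ‖u‖ = 1 →
      ‖(∫ z, Complex.exp (-(Complex.I * (⟪u, z⟫ : ℂ))) * Complex.exp (-(t * Φ z))) -
        t * ∫ z, Complex.exp (-(Complex.I * (⟪u, z⟫ : ℂ))) * h z‖ ≤ C * t ^ 2 := by
  obtain ⟨C₁, hC₁⟩ := exists_norm_integral_shiftInt_le hN hint hα0 hα1 hc hm hρ hlow
  have hρ0 : 0 ≤ ρ := by rw [hρ]; positivity
  set M := ∫ y, ‖y‖ ∂N with hM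
  set D : Ed d → ℝ := fun z => m' * Real.exp m' * ‖h z‖ + ‖h z‖ * (‖z‖ * M + m₀) with hD
  have hDint : Integrable D := by
    have h1 := (hI0.const_mul (m' * Real.exp m')).add
      ((hI1.const_mul M).add (hI0.const_mul m₀))
    refine h1.congr (ae_of_all _ fun z => ?_)
    simp only [hD, Pi.add_apply]
    ring
  refine ⟨C₁ + ∫ z, D z, fun t ht ht1 u hu => ?_⟩
  set q := Real.exp (-(t * m₀)) with hq
  have hnorm : ∀ z, ‖Complex.exp (-(Complex.I * (⟪u, z⟫ : ℂ)))‖ = 1 := fun z => by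
    rw [← mul_neg, mul_comm Complex.I, ← Complex.ofReal_neg, Complex.norm_exp_ofReal_mul_I]
  set Ψ : Ed d → ℂ := fun z => levyExp N u z 0 with hΨ
  have hΨmeas : AEStronglyMeasurable Ψ := (measurable_levyExp u 0).aestronglyMeasurable
  set R : Ed d → ℂ := fun z => Complex.exp (-(Complex.I * (⟪u, z⟫ : ℂ))) *
    (q * Complex.exp (-(t * Ψ z)) * (Complex.exp (t * h z) - 1 - t * h z) +
      t * h z * (q * Complex.exp (-(t * Ψ z)) - 1)) with hR
  have hemeas : AEStronglyMeasurable (fun z : Ed d => Complex.exp (-(Complex.I * (⟪u, z⟫ : ℂ)))) :=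
    Measurable.aestronglyMeasurable (by fun_prop)
  have hRle : ∀ z, ‖R z‖ ≤ t ^ 2 * D z := by
    intro z
    simp only [hR]
    rw [norm_mul, hnorm, one_mul]
    exact norm_expansion_remainder_le ht.le ht1 hm₀ hq (levyExp_zero_re_nonneg u z)
      (norm_levyExp_zero_le hN hint hu z) (hbd z)
  have hexp : ∀ {f : Ed d → ℂ}, AEStronglyMeasurable f →
      AEStronglyMeasurable (fun z => Complex.exp (f z)) := fun hf =>
    Complex.continuous_exp.comp_aestronglyMeasurable hf
  have hEm : AEStronglyMeasurable (fun z => (q : ℂ) * Complex.exp (-(t * Ψ z))) :=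
    (hexp (hΨmeas.const_mul _).neg).const_mul _
  have hRint : Integrable R := by
    refine (hDint.const_mul (t ^ 2)).mono' ?_ (ae_of_all _ hRle)
    have hth := hmeas.const_mul (t : ℂ)
    exact hemeas.mul ((hEm.mul (((hexp hth).sub aestronglyMeasurable_const).sub hth)).add
      (hth.mul (hEm.sub aestronglyMeasurable_const)))
  have hS := integrable_shiftInt_zero hN hint hρ0 hu hα0 hα1 hc ht hm (hlow u)
  have hH : Integrable (fun z => Complex.exp (-(Complex.I * (⟪u, z⟫ : ℂ))) * h z) :=
    hI0.mono' (hemeas.mul hmeas) (ae_of_all _ fun z => by rw [norm_mul, hnorm, one_mul])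
  have hsplit : ∀ z, Complex.exp (-(Complex.I * (⟪u, z⟫ : ℂ))) * Complex.exp (-(t * Φ z)) =
      q * shiftInt N u t z 0 + t * (Complex.exp (-(Complex.I * (⟪u, z⟫ : ℂ))) * h z) + R z := by
    intro z
    have e1 : Complex.exp (-(t * Φ z)) = q * Complex.exp (-(t * Ψ z)) * Complex.exp (t * h z) := by
      rw [hΦ, levyExp_zero_shift 0 u, hq, Complex.ofReal_exp, ← Complex.exp_add, ← Complex.exp_add]
      congr 1
      push_cast
      ring
    have e2 : shiftInt N u t z 0 =
        Complex.exp (-(Complex.I * (⟪u, z⟫ : ℂ))) * Complex.exp (-(t * Ψ z)) := by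
      rw [shiftInt, ← Complex.exp_add]
      congr 1
      simp only [hΨ]
      ring
    rw [e1, e2]
    simp only [hR]
    ring
  simp only [hsplit]
  have hS' := hS.const_mul (q : ℂ)
  have hH' := hH.const_mul (t : ℂ)
  rw [integral_add (f := fun z => (q : ℂ) * shiftInt N u t z 0 +
      t * (Complex.exp (-(Complex.I * (⟪u, z⟫ : ℂ))) * h z)) (hS'.add hH') hRint,
    integral_add hS' hH', integral_const_mul, integral_const_mul,
    add_sub_right_comm, add_sub_cancel_right]
  refine (norm_add_le _ _).trans ?_
  rw [add_mul]
  refine add_le_add ?_ ?_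
  · rw [norm_mul, Complex.norm_real, Real.norm_of_nonneg (by positivity)]
    refine (mul_le_of_le_one_left (norm_nonneg _) ?_).trans (hC₁ t ht ht1 u hu)
    rw [hq]
    exact Real.exp_le_one_iff.mpr (by nlinarith)
  · rw [mul_comm, ← integral_const_mul]
    exact norm_integral_le_of_norm_le (hDint.const_mul _) (ae_of_all _ hRle)

end Expansion

section PolarLevyMeasure

variable {d : ℕ}

lemma ae_fst_mem_prod_restrict {S : Set ℝ} (hS : MeasurableSet S) :
    ∀ᵐ q : ℝ × Ed d ∂((volume.restrict S).prod volume), q.1 ∈ S :=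
  Measure.quasiMeasurePreserving_fst.ae (ae_restrict_mem hS)

/-- The density of the Lévy measure in the coordinates `(s, w) ↦ s • w`. -/
def polarDensity (φ : Ed d → ℝ) (α : ℝ) (q : ℝ × Ed d) : ℝ≥0∞ :=
  ENNReal.ofReal (q.1 ^ (-α - 1) * φ q.2)

/-- The Lévy measure of the small jumps `s • w` with `0 < s ≤ r`. -/
def smallLevy (φ : Ed d → ℝ) (α r : ℝ) : Measure (Ed d) :=
  ((((volume : Measure ℝ).restrict (Set.Ioc 0 r)).prod volume).withDensity
    (polarDensity φ α)).map (fun q => q.1 • q.2)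

instance (φ : Ed d → ℝ) (α r : ℝ) : SFinite (smallLevy φ α r) := by
  unfold smallLevy; infer_instance

lemma measurable_polarDensity {φ : Ed d → ℝ} (hφ : Continuous φ) (α : ℝ) :
    Measurable (polarDensity φ α) := by
  have := hφ.measurable
  unfold polarDensity; fun_prop

lemma measurable_polar_smul : Measurable (fun q : ℝ × Ed d => q.1 • q.2) := by fun_prop

lemma smallLevy_norm_le {φ : Ed d → ℝ} (hφ : Continuous φ) (hb : ∀ w, φ w ≠ 0 → ‖w‖ ≤ 2)
    (α r : ℝ) : ∀ᵐ y ∂(smallLevy φ α r), ‖y‖ ≤ 2 * r := by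
  unfold smallLevy
  rw [ae_map_iff measurable_polar_smul.aemeasurable (measurableSet_le (by fun_prop) (by fun_prop)),
    ae_withDensity_iff (measurable_polarDensity hφ α)]
  refine (ae_fst_mem_prod_restrict measurableSet_Ioc).mono fun q hq h => ?_
  have h1 : φ q.2 ≠ 0 := by
    intro h0; apply h; simp [polarDensity, h0]
  have h2 := hb _ h1
  rw [norm_smul, Real.norm_of_nonneg hq.1.le, mul_comm]
  exact mul_le_mul h2 hq.2 hq.1.le zero_le_two

lemma integrable_smallLevy_norm {φ : Ed d → ℝ} (hφ : Continuous φ) (hsupp : HasCompactSupport φ)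
    (h0 : ∀ w, 0 ≤ φ w) {α r : ℝ} (hα1 : α < 1) (hr : 0 < r) :
    Integrable (fun y => ‖y‖) (smallLevy φ α r) := by
  unfold smallLevy
  rw [integrable_map_measure (by fun_prop) measurable_polar_smul.aemeasurable,
    integrable_withDensity_iff_integrable_smul' (measurable_polarDensity hφ α)
      (ae_of_all _ fun q => ENNReal.ofReal_lt_top)]
  have h1 : IntegrableOn (fun s : ℝ => s ^ (-α)) (Set.Ioc 0 r) :=
    (intervalIntegrable_iff_integrableOn_Ioc_of_le hr.le).mp
      (intervalIntegral.intervalIntegrable_rpow' (by linarith))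
  have h2 : Integrable (fun w : Ed d => φ w * ‖w‖) :=
    Continuous.integrable_of_hasCompactSupport (by fun_prop) hsupp.mul_right
  refine (h1.mul_prod h2).congr ?_
  refine (ae_fst_mem_prod_restrict measurableSet_Ioc).mono fun q hq => ?_
  have hs : 0 < q.1 := hq.1
  have e : q.1 ^ (-α) = q.1 * q.1 ^ (-α - 1) := by
    nth_rewrite 2 [← Real.rpow_one q.1]
    rw [← Real.rpow_add hs]; congr 1; ring
  simp only [polarDensity, Function.comp]
  rw [ENNReal.toReal_ofReal (mul_nonneg (by positivity) (h0 _)), norm_smul,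
    Real.norm_of_nonneg hs.le, e, smul_eq_mul]
  ring

/-- The exponent of the Lévy measure with density `φ w * s ^ (-α - 1)` at `s • w`. -/
def polarExp (φ : Ed d → ℝ) (α : ℝ) (z : Ed d) : ℂ :=
  ∫ w, (φ w : ℂ) * stableKernel α ⟪w, z⟫

/-- The integrand of `polarExp`, as a function of both polar variables. -/
def polarInt (φ : Ed d → ℝ) (α : ℝ) (z : Ed d) (q : ℝ × Ed d) : ℂ :=
  (φ q.2 : ℂ) * subInt α (-(Complex.I * (⟪q.2, z⟫ : ℝ))) q.1

lemma measurable_polarInt {φ : Ed d → ℝ} (hφ : Continuous φ) (α : ℝ) (z : Ed d) :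
    Measurable (polarInt φ α z) := by
  have := hφ.measurable
  unfold polarInt subInt; fun_prop

lemma integrable_polarInt {φ : Ed d → ℝ} (hφ : Continuous φ) (hsupp : HasCompactSupport φ)
    (h0 : ∀ w, 0 ≤ φ w) (hb : ∀ w, φ w ≠ 0 → ‖w‖ ≤ 2) {α : ℝ} (hα0 : 0 < α) (hα1 : α < 1)
    (z : Ed d) :
    Integrable (polarInt φ α z) (((volume : Measure ℝ).restrict (Set.Ioi 0)).prod volume) := by
  have h1 := integrableOn_Ioi_min_mul_rpow hα0 hα1 (K := 2 * ‖z‖) (by positivity)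
  have h2 : Integrable φ := hφ.integrable_of_hasCompactSupport hsupp
  refine (h1.mul_prod h2).mono' (measurable_polarInt hφ α z).aestronglyMeasurable ?_
  refine (ae_fst_mem_prod_restrict measurableSet_Ioi).mono fun q hq => ?_
  have hs : 0 < q.1 := hq
  unfold polarInt
  rw [norm_mul, Complex.norm_real, Real.norm_of_nonneg (h0 _), mul_comm]
  by_cases hw : φ q.2 = 0
  · simp [hw]
  · have hw2 := hb _ hw
    have h3 := norm_subInt_le α (r := -(Complex.I * (⟪q.2, z⟫ : ℝ))) (by simp) hs
    rw [norm_neg, norm_mul, Complex.norm_I, one_mul, Complex.norm_real, Real.norm_eq_abs] at h3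
    have h4 : |⟪q.2, z⟫| ≤ 2 * ‖z‖ :=
      (abs_real_inner_le_norm _ _).trans (by gcongr)
    refine mul_le_mul_of_nonneg_right (h3.trans ?_) (h0 _)
    gcongr

lemma levyExp_smallLevy {φ : Ed d → ℝ} (hφ : Continuous φ) (h0 : ∀ w, 0 ≤ φ w) (α r : ℝ)
    (u z : Ed d) :
    levyExp (smallLevy φ α r) u z 0 =
      ∫ q, polarInt φ α z q ∂(((volume : Measure ℝ).restrict (Set.Ioc 0 r)).prod volume) := by
  unfold levyExp smallLevy
  have hm := measurable_cpair_left u z 0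
  rw [integral_map measurable_polar_smul.aemeasurable
    (Measurable.aestronglyMeasurable (by fun_prop)),
    integral_withDensity_eq_integral_toReal_smul (measurable_polarDensity hφ α)
      (ae_of_all _ fun q => ENNReal.ofReal_lt_top)]
  refine integral_congr_ae ((ae_fst_mem_prod_restrict measurableSet_Ioc).mono fun q hq => ?_)
  have hs : 0 < q.1 := hq.1
  simp only [polarDensity, polarInt, subInt, cpair]
  rw [ENNReal.toReal_ofReal (mul_nonneg (by positivity) (h0 _)), Complex.real_smul,
    inner_smul_left]
  simp only [conj_trivial]
  push_cast
  rw [zero_mul, add_zero, neg_mul, neg_neg, mul_assoc Complex.I, mul_comm (⟪q.2, z⟫ : ℂ)]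
  ring

lemma integral_polarInt_right {φ : Ed d → ℝ} (hφ : Continuous φ) (hsupp : HasCompactSupport φ)
    {α : ℝ} (s : ℝ) (z : Ed d) :
    ∫ w, polarInt φ α z (s, w) =
      ((∫ w, φ w : ℝ) : ℂ) * ((s ^ (-α - 1) : ℝ) : ℂ) -
        charFT φ (s • z) * ((s ^ (-α - 1) : ℝ) : ℂ) := by
  have h1 : Integrable (fun w => (φ w : ℂ)) := (hφ.integrable_of_hasCompactSupport hsupp).ofReal
  have h2 : Integrable (fun w : Ed d => Complex.exp (Complex.I * (⟪w, s • z⟫ : ℂ)) * (φ w : ℂ)) := by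
    refine h1.norm.mono' (Measurable.aestronglyMeasurable ?_) (ae_of_all _ fun w => ?_)
    · have := hφ.measurable
      fun_prop
    · rw [norm_mul, mul_comm Complex.I, Complex.norm_exp_ofReal_mul_I, one_mul]
  rw [← sub_mul, ← integral_complex_ofReal]
  unfold charFT
  rw [← integral_sub h1 h2, ← integral_mul_const]
  congr 1
  funext w
  simp only [polarInt, subInt]
  rw [inner_smul_right, neg_mul, neg_neg]
  push_cast
  rw [mul_assoc Complex.I, mul_comm (⟪w, z⟫ : ℂ)]
  ring

lemma polarExp_eq {φ : Ed d → ℝ} (hφ : ContDiff ℝ (⊤ : ℕ∞) φ) (hsupp : HasCompactSupport φ)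
    (h0 : ∀ w, 0 ≤ φ w) (hb : ∀ w, φ w ≠ 0 → ‖w‖ ≤ 2) {α r : ℝ} (hα0 : 0 < α) (hα1 : α < 1)
    (hr : 0 < r) (u z : Ed d) :
    polarExp φ α z = levyExp (smallLevy φ α r) u z 0 +
      (((∫ w, φ w) * ∫ s in Set.Ioi r, s ^ (-α - 1) : ℝ) : ℂ) - largeFT φ α r z := by
  have hc := hφ.continuous
  have hI := integrable_polarInt hc hsupp h0 hb hα0 hα1 z
  have hsub : (volume : Measure ℝ).restrict (Set.Ioc 0 r) ≤ volume.restrict (Set.Ioi 0) :=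
    Measure.restrict_mono Set.Ioc_subset_Ioi_self le_rfl
  have hIs := hI.mono_measure (Measure.prod_mono hsub le_rfl)
  rw [levyExp_smallLevy hc h0, integral_prod _ hIs]
  have e1 : polarExp φ α z = ∫ s in Set.Ioi 0, ∫ w, polarInt φ α z (s, w) := by
    rw [integral_integral_swap (f := fun s w => polarInt φ α z (s, w)) hI]
    unfold polarExp stableKernel polarInt
    simp only [integral_const_mul]
  have hprod := hI.integral_prod_left
  rw [e1, ← Set.Ioc_union_Ioi_eq_Ioi hr.le, setIntegral_union
    (Set.Ioc_disjoint_Ioi le_rfl) measurableSet_Ioi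
    (IntegrableOn.mono_set hprod Set.Ioc_subset_Ioi_self)
    (IntegrableOn.mono_set hprod (Set.Ioi_subset_Ioi hr.le)), add_sub_assoc]
  congr 1
  simp only [integral_polarInt_right hc hsupp]
  have h1 : IntegrableOn (fun s : ℝ => ((s ^ (-α - 1) : ℝ) : ℂ)) (Set.Ioi r) :=
    (integrableOn_rpow_neg hα0 hr).ofReal
  have h2 : IntegrableOn (fun s : ℝ => charFT φ (s • z) * ((s ^ (-α - 1) : ℝ) : ℂ)) (Set.Ioi r) := by
    refine (h1.norm.const_mul (∫ w, |φ w|)).mono' (Measurable.aestronglyMeasurable ?_)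
      (ae_of_all _ fun s => ?_)
    · have := (continuous_charFT hφ hsupp).measurable
      fun_prop
    · rw [norm_mul]
      gcongr
      exact norm_charFT_le _ _
  rw [integral_sub (h1.const_mul _) h2, integral_const_mul, integral_complex_ofReal]
  push_cast
  rfl

end PolarLevyMeasure

section PolarExpansion

variable {d : ℕ}

/-- The constant relating the Lévy measure to the spectral measure. -/
def stableConst (α : ℝ) : ℝ := Real.Gamma (1 - α) / α * Real.cos (π * α / 2)

lemma stableConst_pos {α : ℝ} (hα0 : 0 < α) (hα1 : α < 1) : 0 < stableConst α := by
  have h1 : 0 < Real.Gamma (1 - α) := Real.Gamma_pos_of_pos (by linarith)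
  have h2 : 0 < Real.cos (π * α / 2) := by
    apply Real.cos_pos_of_mem_Ioo
    constructor <;> nlinarith [Real.pi_pos]
  unfold stableConst
  positivity

lemma re_stableKernel {α : ℝ} (hα0 : 0 < α) (hα1 : α < 1) (x : ℝ) :
    (stableKernel α x).re = stableConst α * |x| ^ α := by
  rw [stableKernel_eq hα0 hα1, Complex.re_ofReal_mul, Complex.re_ofReal_mul]
  have : (1 - Complex.I * (Real.tan (π * α / 2) : ℂ) * (Real.sign x : ℂ)).re = 1 := by
    generalize Real.tan (π * α / 2) = T
    simp
  rw [this, mul_one]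
  rfl

lemma integrable_stableKernel {φ : Ed d → ℝ} (hφ : Continuous φ) (hsupp : HasCompactSupport φ)
    (h0 : ∀ w, 0 ≤ φ w) (hb : ∀ w, φ w ≠ 0 → ‖w‖ ≤ 2) {α : ℝ} (hα0 : 0 < α) (hα1 : α < 1)
    (z : Ed d) : Integrable (fun w => (φ w : ℂ) * stableKernel α ⟪w, z⟫) := by
  have h := (integrable_polarInt hφ hsupp h0 hb hα0 hα1 z).integral_prod_right
  simp only [polarInt, integral_const_mul] at h
  exact h

lemma re_polarExp {φ : Ed d → ℝ} (hφ : Continuous φ) (hsupp : HasCompactSupport φ)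
    (h0 : ∀ w, 0 ≤ φ w) (hb : ∀ w, φ w ≠ 0 → ‖w‖ ≤ 2) {α : ℝ} (hα0 : 0 < α) (hα1 : α < 1)
    (z : Ed d) : (polarExp φ α z).re = stableConst α * ∫ w, φ w * |⟪w, z⟫| ^ α := by
  have h := integral_re (integrable_stableKernel hφ hsupp h0 hb hα0 hα1 z)
  simp only [RCLike.re_to_complex] at h
  unfold polarExp
  rw [← h, ← integral_const_mul]
  congr 1
  funext w
  rw [Complex.re_ofReal_mul, re_stableKernel hα0 hα1]
  ring

lemma continuous_mul_abs_inner_rpow {φ : Ed d → ℝ} (hφ : Continuous φ) {α : ℝ} (hα0 : 0 < α)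
    (z : Ed d) : Continuous (fun w => φ w * |⟪w, z⟫| ^ α) :=
  hφ.mul (Continuous.rpow_const (by fun_prop) fun _ => Or.inr hα0.le)

lemma integral_mul_abs_inner_rpow_pos {φ : Ed d → ℝ} (hφ : Continuous φ)
    (hsupp : HasCompactSupport φ) (h0 : ∀ w, 0 ≤ φ w) {w₀ : Ed d} (hw₀ : φ w₀ ≠ 0) {α : ℝ}
    (hα0 : 0 < α) {z : Ed d} (hz : z ≠ 0) : 0 < ∫ w, φ w * |⟪w, z⟫| ^ α := by
  obtain ⟨w, hw, hwz⟩ : ∃ w, φ w ≠ 0 ∧ ⟪w, z⟫ ≠ 0 := by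
    by_cases h : ⟪w₀, z⟫ = 0
    · have h1 : Tendsto (fun ε : ℝ => φ (w₀ + ε • z)) (𝓝[>] 0) (𝓝 (φ w₀)) := by
        have : Continuous (fun ε : ℝ => φ (w₀ + ε • z)) := by fun_prop
        have h2 := this.tendsto 0
        rw [zero_smul, add_zero] at h2
        exact h2.mono_left nhdsWithin_le_nhds
      obtain ⟨ε, hε, hε0⟩ := ((h1.eventually_ne hw₀).and self_mem_nhdsWithin).exists
      refine ⟨w₀ + ε • z, hε, ?_⟩
      rw [inner_add_left, h, zero_add, inner_smul_left, real_inner_self_eq_norm_sq]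
      have hε0' : ε ≠ 0 := ne_of_gt hε0
      simpa using ⟨hε0', hz⟩
    · exact ⟨w₀, hw₀, h⟩
  refine (continuous_mul_abs_inner_rpow hφ hα0 z).integral_pos_of_hasCompactSupport_nonneg_nonzero
    hsupp.mul_right (fun w => mul_nonneg (h0 w) (by positivity)) (x := w) ?_
  have : 0 < |⟪w, z⟫| := abs_pos.mpr hwz
  exact mul_ne_zero hw (by positivity)

lemma exists_le_integral_mul_abs_inner_rpow {φ : Ed d → ℝ} (hφ : Continuous φ)
    (hsupp : HasCompactSupport φ) (h0 : ∀ w, 0 ≤ φ w) {w₀ : Ed d} (hw₀ : φ w₀ ≠ 0) {α : ℝ}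
    (hα0 : 0 < α) : ∃ c, 0 < c ∧ ∀ z, c * ‖z‖ ^ α ≤ ∫ w, φ w * |⟪w, z⟫| ^ α := by
  have hcont : ContinuousOn (fun z : Ed d => ∫ w, φ w * |⟪w, z⟫| ^ α) (Metric.sphere 0 1) := by
    refine continuousOn_of_dominated (bound := fun w => φ w * ‖w‖ ^ α) (fun z _ =>
      (continuous_mul_abs_inner_rpow hφ hα0 z).aestronglyMeasurable) (fun z hz => ?_) ?_ ?_
    · refine ae_of_all _ fun w => ?_
      rw [norm_mul, Real.norm_of_nonneg (h0 w), Real.norm_of_nonneg (by positivity)]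
      have h1 := abs_real_inner_le_norm w z
      rw [mem_sphere_zero_iff_norm.mp hz, mul_one] at h1
      have := h0 w
      gcongr
    · exact Continuous.integrable_of_hasCompactSupport
        (hφ.mul (continuous_norm.rpow_const fun _ => Or.inr hα0.le)) hsupp.mul_right
    · refine ae_of_all _ fun w => Continuous.continuousOn ?_
      exact continuous_const.mul (Continuous.rpow_const (by fun_prop) fun _ => Or.inr hα0.le)
  obtain ⟨c, hc, hle⟩ := (isCompact_sphere (0 : Ed d) 1).exists_forall_le' hcont (a := 0)
    (fun z hz => integral_mul_abs_inner_rpow_pos hφ hsupp h0 hw₀ hα0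
      (ne_zero_of_mem_unit_sphere ⟨z, hz⟩))
  refine ⟨c, hc, fun z => ?_⟩
  rcases eq_or_ne z 0 with rfl | hz
  · simp [Real.zero_rpow hα0.ne']
  · have hz' : 0 < ‖z‖ := norm_pos_iff.mpr hz
    have h1 := hle (‖z‖⁻¹ • z) (by
      rw [mem_sphere_zero_iff_norm, norm_smul, norm_inv, norm_norm, inv_mul_cancel₀ hz'.ne'])
    have h2 : ∀ w : Ed d, φ w * |⟪w, z⟫| ^ α =
        ‖z‖ ^ α * (φ w * |⟪w, ‖z‖⁻¹ • z⟫| ^ α) := by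
      intro w
      rw [inner_smul_right, abs_mul, abs_of_pos (inv_pos.mpr hz'),
        Real.mul_rpow (by positivity) (abs_nonneg _), Real.inv_rpow hz'.le]
      field_simp
    simp only [h2]
    rw [integral_const_mul, mul_comm]
    gcongr

theorem exists_polar_expansion {φ : Ed d → ℝ} (hφ : ContDiff ℝ (⊤ : ℕ∞) φ)
    (hsupp : HasCompactSupport φ) (h0 : ∀ w, 0 ≤ φ w) (hb : ∀ w, φ w ≠ 0 → ‖w‖ ≤ 2)
    {w₀ : Ed d} (hw₀ : φ w₀ ≠ 0) {α : ℝ} (hα0 : 0 < α) (hα1 : α < 1) :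
    ∃ C : ℝ, ∀ t : ℝ, 0 < t → t ≤ 1 → ∀ u : Ed d, ‖u‖ = 1 →
      ‖(∫ z, Complex.exp (-(Complex.I * (⟪u, z⟫ : ℂ))) * Complex.exp (-(t * polarExp φ α z))) -
        t * (((2 * π) ^ d : ℝ) *
          ((∫ s in Set.Ioi 0, φ (s⁻¹ • u) * s ^ (-α - 1 - d) : ℝ) : ℂ))‖ ≤ C * t ^ 2 := by
  have hc := hφ.continuous
  set ρ : ℝ := 1 / (4 + 3 * d / α) with hρ
  have hρ0 : 0 < ρ := by rw [hρ]; positivity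
  have hρ1 : ρ ≤ 1 / 4 := by
    rw [hρ]
    apply one_div_le_one_div_of_le (by norm_num)
    have : 0 ≤ 3 * d / α := by positivity
    linarith
  set r := ρ / 2 with hr
  have hr0 : 0 < r := by positivity
  set m₀ := (∫ w, φ w) * ∫ s in Set.Ioi r, s ^ (-α - 1) with hm₀
  have hm₀0 : 0 ≤ m₀ := mul_nonneg (integral_nonneg h0)
    (setIntegral_nonneg measurableSet_Ioi fun s hs => by
      have : 0 < s := hr0.trans hs
      positivity)
  have hN := smallLevy_norm_le hc hb α r
  rw [show 2 * r = ρ by rw [hr]; ring] at hN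
  have hlarge : ∀ z, ‖largeFT φ α r z‖ ≤ m₀ := fun z => by
    have := norm_largeFT_le φ hα0 hr0 z
    simpa only [abs_of_nonneg (h0 _)] using this
  have hΦ := polarExp_eq hφ hsupp h0 hb hα0 hα1 hr0
  obtain ⟨c, hc0, hlow⟩ := exists_le_integral_mul_abs_inner_rpow hc hsupp h0 hw₀ hα0
  obtain ⟨C, hC⟩ := exists_norm_integral_sub_le (N := smallLevy φ α r) (ρ := ρ) (α := α)
    (c := stableConst α * c) (m := 2 * m₀) (m₀ := m₀) (m' := m₀) (h := largeFT φ α r)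
    (Φ := polarExp φ α) hN (integrable_smallLevy_norm hc hsupp h0 hα1 hr0) hα0 hα1
    (mul_pos (stableConst_pos hα0 hα1) hc0) (by positivity) hm₀0 hρ
    (fun u z => by
      have h1 := congrArg Complex.re (hΦ u z)
      rw [re_polarExp hc hsupp h0 hb hα0 hα1, Complex.sub_re, Complex.add_re,
        Complex.ofReal_re] at h1
      have h2 := mul_le_mul_of_nonneg_left (hlow z) (stableConst_pos hα0 hα1).le
      have h3 := (abs_le.mp ((Complex.abs_re_le_norm _).trans (hlarge z))).1
      linarith)
    (aestronglyMeasurable_largeFT hφ hsupp hα0 hr0) hlarge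
    (by simpa using integrable_pow_mul_largeFT hφ hsupp hα0 hr0 0)
    (by simpa using integrable_pow_mul_largeFT hφ hsupp hα0 hr0 1) (hΦ 0)
  refine ⟨C, fun t ht ht1 u hu => ?_⟩
  have h1 := hC t ht ht1 u hu
  rw [integral_exp_neg_mul_largeFT hφ hsupp hα0 hr0] at h1
  rwa [setIntegral_eq_of_subset_of_forall_sdiff_eq_zero measurableSet_Ioi
    (Set.Ioi_subset_Ioi hr0.le) (f := fun s : ℝ => φ (s⁻¹ • u) * s ^ (-α - 1 - d))]
  rintro s ⟨hs0, hsr⟩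
  have hs0 : 0 < s := hs0
  have hsr : s ≤ r := not_lt.mp hsr
  by_contra hne
  have h2 := hb _ (left_ne_zero_of_mul hne)
  rw [norm_smul, hu, mul_one, norm_inv, Real.norm_of_nonneg hs0.le] at h2
  have h3 : 1 ≤ 2 * s := by rwa [inv_le_iff_one_le_mul₀ hs0] at h2
  linarith

end PolarExpansion

section Polar

variable {d : ℕ}

lemma integral_norm_mul_unit [NeZero d] (A : ℝ → ℂ) (B : Ed d → ℂ) :
    ∫ w : Ed d, A ‖w‖ * B (‖w‖⁻¹ • w) =
      (∫ v, B (v : Ed d) ∂(ωd d)) * ∫ ρ in Set.Ioi (0 : ℝ), ((ρ ^ (d - 1) : ℝ) : ℂ) * A ρ := by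
  have hdim : Module.finrank ℝ (Ed d) = d := finrank_euclideanSpace_fin
  calc
    ∫ w : Ed d, A ‖w‖ * B (‖w‖⁻¹ • w)
        = ∫ w : ({(0)}ᶜ : Set (Ed d)), A ‖w.1‖ * B (‖w.1‖⁻¹ • w.1)
            ∂((volume : Measure (Ed d)).comap (↑)) := by
      rw [integral_subtype_comap (measurableSet_singleton _).compl
        fun w : Ed d => A ‖w‖ * B (‖w‖⁻¹ • w), restrict_compl_singleton]
    _ = ∫ q, B (q.1 : Ed d) * A q.2 ∂(ωd d).prod (.volumeIoiPow (d - 1)) := by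
      have h := (volume : Measure (Ed d)).measurePreserving_homeomorphUnitSphereProd.integral_comp
        (Homeomorph.measurableEmbedding _)
        (fun q : Sph d × Set.Ioi (0 : ℝ) => B (q.1 : Ed d) * A q.2)
      rw [hdim] at h
      rw [ωd, ← h]
      refine integral_congr_ae (Eventually.of_forall fun w => ?_)
      simp [mul_comm]
    _ = (∫ v, B (v : Ed d) ∂(ωd d)) * ∫ ρ : Set.Ioi (0 : ℝ), A ρ ∂.volumeIoiPow (d - 1) :=
      by
        have : SFinite (ωd d) := by unfold ωd; infer_instance
        exact integral_prod_mul (fun v : Sph d => B (v : Ed d)) (fun ρ : Set.Ioi (0 : ℝ) => A ρ)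
    _ = _ := by
      congr 1
      simp only [Measure.volumeIoiPow, ENNReal.ofReal]
      rw [integral_withDensity_eq_integral_smul
          (measurable_subtype_coe.pow_const _).real_toNNReal,
        integral_subtype_comap measurableSet_Ioi fun a => Real.toNNReal (a ^ (d - 1)) • A a,
        setIntegral_congr_fun measurableSet_Ioi fun x hx => ?_]
      rw [NNReal.smul_def, Real.coe_toNNReal _ (pow_nonneg hx.out.le _), Complex.real_smul]

lemma sign_pos_mul {r : ℝ} (hr : 0 < r) (x : ℝ) : Real.sign (r * x) = Real.sign x := by
  rcases lt_trichotomy x 0 with h | h | h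
  · rw [Real.sign_of_neg h, Real.sign_of_neg (mul_neg_of_pos_of_neg hr h)]
  · simp [h]
  · rw [Real.sign_of_pos h, Real.sign_of_pos (mul_pos hr h)]

lemma stableKernel_pos_mul {α : ℝ} (hα0 : 0 < α) (hα1 : α < 1) {r : ℝ} (hr : 0 < r) (x : ℝ) :
    stableKernel α (r * x) = ((r ^ α : ℝ) : ℂ) * stableKernel α x := by
  rw [stableKernel_eq hα0 hα1, stableKernel_eq hα0 hα1, sign_pos_mul hr, abs_mul,
    abs_of_pos hr, Real.mul_rpow hr.le (abs_nonneg _)]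
  push_cast
  ring

lemma charExp_smul (α : ℝ) (Λ : Measure (Sph d)) {r : ℝ} (hr : 0 < r) (z : Ed d) :
    charExp d α Λ (r • z) = ((r ^ α : ℝ) : ℂ) * charExp d α Λ z := by
  unfold charExp
  rw [← integral_const_mul]
  congr 1
  funext v
  rw [real_inner_smul_left, sign_pos_mul hr, abs_mul, abs_of_pos hr,
    Real.mul_rpow hr.le (abs_nonneg _)]
  push_cast
  ring

lemma charExp_specMeasure {α : ℝ} {P : Sph d → ℝ} (hP : Measurable P) (hP0 : ∀ u, 0 ≤ P u)
    (z : Ed d) : charExp d α (specMeasure d P) z =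
      ∫ v, (P v : ℂ) * ((|⟪z, (v : Ed d)⟫| ^ α : ℝ) * (1 - Complex.I *
        (Real.tan (Real.pi * α / 2) : ℂ) * (Real.sign ⟪z, (v : Ed d)⟫ : ℂ))) ∂(ωd d) := by
  unfold charExp specMeasure
  rw [integral_withDensity_eq_integral_toReal_smul (by fun_prop) (by simp)]
  congr 1
  funext v
  rw [ENNReal.toReal_ofReal (hP0 v), Complex.real_smul]

/-- A radial extension of a function on the sphere. -/
def radialExt (ψ : ℝ → ℝ) (p : Ed d → ℝ) (w : Ed d) : ℝ := ψ ‖w‖ * p (‖w‖⁻¹ • w)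

lemma polarExp_radialExt [NeZero d] {α : ℝ} (hα0 : 0 < α) (hα1 : α < 1) {ψ : ℝ → ℝ}
    {p : Ed d → ℝ} {P : Sph d → ℝ} (hP : Measurable P) (hP0 : ∀ u, 0 ≤ P u)
    (hpP : ∀ u : Sph d, p u = P u) (hψ : ψ 0 = 0) (z : Ed d) :
    polarExp (radialExt ψ p) α z =
      ((stableConst α * ∫ ρ in Set.Ioi (0 : ℝ), ρ ^ (α + d - 1) * ψ ρ : ℝ) : ℂ) *
        charExp d α (specMeasure d P) z := by
  have h1 : ∀ w : Ed d, (radialExt ψ p w : ℂ) * stableKernel α ⟪w, z⟫ =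
      ((ψ ‖w‖ * ‖w‖ ^ α : ℝ) : ℂ) *
        ((p (‖w‖⁻¹ • w) : ℂ) * stableKernel α ⟪‖w‖⁻¹ • w, z⟫) := by
    intro w
    rcases eq_or_ne w 0 with rfl | hw
    · simp [radialExt, hψ]
    · have hw' := norm_pos_iff.mpr hw
      have h2 : ⟪w, z⟫ = ‖w‖ * ⟪‖w‖⁻¹ • w, z⟫ := by
        rw [real_inner_smul_left, mul_inv_cancel_left₀ hw'.ne']
      conv_lhs => rw [h2, stableKernel_pos_mul hα0 hα1 hw', radialExt]
      push_cast
      ring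
  unfold polarExp
  simp_rw [h1]
  rw [integral_norm_mul_unit (fun ρ => ((ψ ρ * ρ ^ α : ℝ) : ℂ))
    (fun w => (p w : ℂ) * stableKernel α ⟪w, z⟫), charExp_specMeasure hP hP0]
  have h3 : ∫ v, (p (v : Ed d) : ℂ) * stableKernel α ⟪(v : Ed d), z⟫ ∂(ωd d) =
      (stableConst α : ℂ) * ∫ v, (P v : ℂ) * ((|⟪z, (v : Ed d)⟫| ^ α : ℝ) * (1 - Complex.I *
        (Real.tan (Real.pi * α / 2) : ℂ) * (Real.sign ⟪z, (v : Ed d)⟫ : ℂ))) ∂(ωd d) := by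
    rw [← integral_const_mul]
    congr 1
    funext v
    rw [hpP, stableKernel_eq hα0 hα1, real_inner_comm z, ← stableConst]
    ring
  have h4 : ∫ ρ in Set.Ioi (0 : ℝ), ((ρ ^ (d - 1) : ℝ) : ℂ) * ((ψ ρ * ρ ^ α : ℝ) : ℂ) =
      ((∫ ρ in Set.Ioi (0 : ℝ), ρ ^ (α + d - 1) * ψ ρ : ℝ) : ℂ) := by
    rw [← integral_complex_ofReal]
    refine setIntegral_congr_fun measurableSet_Ioi fun ρ hρ => ?_
    have hρ : 0 < ρ := hρ
    have h5 : ρ ^ (α + d - 1) = ρ ^ α * ρ ^ (d - 1) := by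
      rw [add_sub_assoc, Real.rpow_add hρ, ← Real.rpow_natCast ρ (d - 1),
        Nat.cast_sub (NeZero.one_le), Nat.cast_one]
    simp only [h5]
    push_cast
    ring
  rw [h3, h4]
  push_cast
  ring

lemma integral_radialExt_inv_smul {α : ℝ} {ψ : ℝ → ℝ} {p : Ed d → ℝ} {u : Ed d}
    (hu : ‖u‖ = 1) :
    ∫ s in Set.Ioi (0 : ℝ), radialExt ψ p (s⁻¹ • u) * s ^ (-α - 1 - d) =
      p u * ∫ ρ in Set.Ioi (0 : ℝ), ρ ^ (α + d - 1) * ψ ρ := by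
  rw [← integral_comp_rpow_Ioi (fun ρ : ℝ => ρ ^ (α + d - 1) * ψ ρ) (p := -1) (by norm_num),
    ← integral_const_mul]
  refine setIntegral_congr_fun measurableSet_Ioi fun s hs => ?_
  have hs : 0 < s := hs
  have h1 : ‖s⁻¹ • u‖ = s⁻¹ := by
    rw [norm_smul, hu, mul_one, norm_inv, Real.norm_of_nonneg hs.le]
  have h2 : s⁻¹⁻¹ • s⁻¹ • u = u := by rw [inv_inv, smul_inv_smul₀ hs.ne']
  have h3 : s ^ (-α - 1 - d) = s ^ (-1 - 1 : ℝ) * (s⁻¹) ^ (α + d - 1) := by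
    rw [Real.inv_rpow hs.le, ← Real.rpow_neg hs.le, ← Real.rpow_add hs]
    congr 1
    ring
  simp only [radialExt, h1, h2, h3, Real.rpow_neg_one, smul_eq_mul, abs_neg, abs_one]
  ring

lemma inv_stableConst {α : ℝ} (hα0 : 0 < α) (hα1 : α < 1) :
    (stableConst α)⁻¹ = 2 * α * Real.Gamma α * Real.sin (π * α / 2) / π := by
  have h0 := (stableConst_pos hα0 hα1).ne'
  have h1 := Real.Gamma_mul_Gamma_one_sub α
  have h2 : Real.sin (π * α) = 2 * Real.sin (π * α / 2) * Real.cos (π * α / 2) := by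
    rw [← Real.sin_two_mul]
    congr 1
    ring
  have h3 : 0 < Real.sin (π * α) :=
    Real.sin_pos_of_pos_of_lt_pi (by positivity) (by nlinarith [Real.pi_pos])
  rw [eq_div_iff Real.pi_ne_zero, inv_mul_eq_iff_eq_mul₀ h0]
  rw [eq_div_iff h3.ne'] at h1
  rw [h2] at h1
  unfold stableConst
  generalize Real.sin (π * α / 2) = S at *
  generalize Real.cos (π * α / 2) = K at *
  field_simp
  linarith

end Polar

section Extension

variable {d : ℕ}

lemma contDiff_mvPolynomial_eval (p : MvPolynomial (Fin d) ℝ) (n : WithTop ℕ∞) :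
    ContDiff ℝ n (fun x : Ed d => MvPolynomial.eval (fun i => x i) p) := by
  induction p using MvPolynomial.induction_on with
  | C a => simpa using contDiff_const
  | add p q hp hq => simpa using hp.add hq
  | mul_X p i hp =>
    simp only [map_mul, MvPolynomial.eval_X]
    exact hp.mul (by fun_prop)

lemma contDiff_radialExt {ψ : ℝ → ℝ} {p : Ed d → ℝ} {n : ℕ∞} (hψ : ContDiff ℝ n ψ)
    (hp : ContDiff ℝ n p) (hψ0 : ψ =ᶠ[𝓝 0] 0) : ContDiff ℝ n (radialExt ψ p) := by
  rw [contDiff_iff_contDiffAt]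
  intro w
  rcases eq_or_ne w 0 with rfl | hw
  · have h1 : Tendsto (fun w : Ed d => ‖w‖) (𝓝 0) (𝓝 0) := by
      simpa using (continuous_norm (E := Ed d)).tendsto 0
    have h2 : radialExt ψ p =ᶠ[𝓝 0] fun _ => 0 := by
      filter_upwards [h1.eventually hψ0] with w hw
      simp [radialExt, hw]
    exact contDiffAt_const.congr_of_eventuallyEq h2
  · have h1 : ContDiffAt ℝ n (fun w : Ed d => ‖w‖) w := contDiffAt_norm ℝ hw
    exact (hψ.contDiffAt.comp w h1).mul
      (hp.contDiffAt.comp w ((h1.inv (norm_ne_zero_iff.mpr hw)).smul contDiffAt_id))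

lemma exists_radial_cutoff : ∃ ψ : ℝ → ℝ, ContDiff ℝ (⊤ : ℕ∞) ψ ∧ (∀ ρ, 0 ≤ ψ ρ) ∧ ψ 1 = 1 ∧
    ∀ ρ, ψ ρ ≠ 0 → 1 / 2 < ρ ∧ ρ < 3 / 2 := by
  let f : ContDiffBump (1 : ℝ) := ⟨1 / 4, 1 / 2, by norm_num, by norm_num⟩
  refine ⟨f, f.contDiff, fun ρ => f.nonneg, f.one_of_mem_closedBall (by simp [f]), ?_⟩
  intro ρ hρ
  have h : ρ ∈ Function.support f := hρ
  rw [f.support_eq, Real.ball_eq_Ioo] at h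
  have h1 := h.1
  have h2 := h.2
  simp only [f] at h1 h2
  constructor <;> linarith

end Extension

section Density

variable {d : ℕ}

lemma exists_polar_density [NeZero d] {α : ℝ} (hα0 : 0 < α) (hα1 : α < 1) {P : Sph d → ℝ}
    (hpoly : IsPolyRestriction d P) (hP0 : ∀ u, 0 ≤ P u) (hPne : P ≠ 0) :
    ∃ φ : Ed d → ℝ, ContDiff ℝ (⊤ : ℕ∞) φ ∧ HasCompactSupport φ ∧ (∀ w, 0 ≤ φ w) ∧
      (∀ w, φ w ≠ 0 → ‖w‖ ≤ 2) ∧ (∃ w₀, φ w₀ ≠ 0) ∧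
      (∀ z, polarExp φ α z = charExp d α (specMeasure d P) z) ∧
      ∀ u : Sph d, ∫ s in Set.Ioi (0 : ℝ), φ (s⁻¹ • (u : Ed d)) * s ^ (-α - 1 - d) =
        (stableConst α)⁻¹ * P u := by
  obtain ⟨q, hq⟩ := hpoly
  let p : Ed d → ℝ := fun x => MvPolynomial.eval (fun i => x i) q
  have hpP : ∀ u : Sph d, p u = P u := fun u => (hq u).symm
  have hp : ContDiff ℝ (⊤ : ℕ∞) p := contDiff_mvPolynomial_eval q _
  have hPm : Measurable P := by
    have h : P = fun u : Sph d => p u := funext hq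
    rw [h]
    exact (hp.continuous.comp continuous_subtype_val).measurable
  obtain ⟨ψ, hψ, hψ0, hψ1, hψs⟩ := exists_radial_cutoff
  obtain ⟨u₀, hu₀⟩ := Function.ne_iff.mp hPne
  have hu₀n : ‖(u₀ : Ed d)‖ = 1 := by simp
  have smooth : ∀ κ : ℝ, ContDiff ℝ (⊤ : ℕ∞) (radialExt (fun ρ => κ * ψ ρ) p) := fun κ => by
    refine contDiff_radialExt (contDiff_const.mul hψ) hp ?_
    filter_upwards [gt_mem_nhds (show (0 : ℝ) < 1 / 2 by norm_num)] with ρ hρ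
    have : ψ ρ = 0 := by
      by_contra h
      linarith [(hψs ρ h).1]
    simp [this]
  have bound : ∀ (κ : ℝ) (w : Ed d), radialExt (fun ρ => κ * ψ ρ) p w ≠ 0 →
      1 / 2 < ‖w‖ ∧ ‖w‖ ≤ 2 := fun κ w hw => by
    have h := hψs _ (right_ne_zero_of_mul (left_ne_zero_of_mul hw))
    exact ⟨h.1, by linarith [h.2]⟩
  have compact : ∀ κ : ℝ, HasCompactSupport (radialExt (fun ρ => κ * ψ ρ) p) := fun κ => by
    refine HasCompactSupport.intro (isCompact_closedBall (0 : Ed d) 2) fun w hw => ?_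
    by_contra h
    exact hw (by simpa using (bound κ w h).2)
  have nonneg : ∀ κ : ℝ, 0 ≤ κ → ∀ w, 0 ≤ radialExt (fun ρ => κ * ψ ρ) p w := fun κ hκ w => by
    by_cases h : radialExt (fun ρ => κ * ψ ρ) p w = 0
    · exact h.ge
    · have hw : w ≠ 0 := by
        rintro rfl
        have := (bound κ 0 h).1
        norm_num at this
      have h1 := hpP (unitize w hw)
      have h2 := hP0 (unitize w hw)
      rw [← h1] at h2
      exact mul_nonneg (mul_nonneg hκ (hψ0 _)) h2
  have pos : ∀ κ : ℝ, 0 < κ → radialExt (fun ρ => κ * ψ ρ) p u₀ ≠ 0 := fun κ hκ => by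
    simp only [radialExt, hu₀n, hψ1, inv_one, one_smul, mul_one, hpP]
    exact mul_ne_zero hκ.ne' hu₀
  have hz : ∀ κ : ℝ, κ * ψ 0 = 0 := fun κ => by
    have : ψ 0 = 0 := by
      by_contra h
      linarith [(hψs 0 h).1]
    simp [this]
  have hint : ∀ κ : ℝ, ∫ ρ in Set.Ioi (0 : ℝ), ρ ^ (α + d - 1) * (κ * ψ ρ) =
      κ * ∫ ρ in Set.Ioi (0 : ℝ), ρ ^ (α + d - 1) * ψ ρ := fun κ => by
    rw [← integral_const_mul]
    congr 1
    funext ρ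
    ring
  set J := ∫ ρ in Set.Ioi (0 : ℝ), ρ ^ (α + d - 1) * ψ ρ with hJ
  have hc := stableConst_pos hα0 hα1
  have hJ0 : 0 < J := by
    refine lt_of_le_of_ne (setIntegral_nonneg measurableSet_Ioi fun ρ hρ =>
      mul_nonneg (Real.rpow_nonneg (le_of_lt hρ) _) (hψ0 ρ)) fun h => ?_
    have h1 := re_polarExp (smooth 1).continuous (compact 1) (nonneg 1 zero_le_one)
      (fun w hw => (bound 1 w hw).2) hα0 hα1 (u₀ : Ed d)
    have h2 := integral_mul_abs_inner_rpow_pos (smooth 1).continuous (compact 1)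
      (nonneg 1 zero_le_one) (pos 1 one_pos) hα0 (z := (u₀ : Ed d))
      (norm_ne_zero_iff.mp (by rw [hu₀n]; exact one_ne_zero))
    have h3 : (polarExp (radialExt (fun ρ => 1 * ψ ρ) p) α u₀).re = 0 := by
      rw [polarExp_radialExt hα0 hα1 hPm hP0 hpP (hz 1), hint, ← h]
      simp
    rw [h3] at h1
    exact (mul_pos hc h2).ne h1
  have hκ : 0 < (stableConst α * J)⁻¹ := by positivity
  refine ⟨radialExt (fun ρ => (stableConst α * J)⁻¹ * ψ ρ) p, smooth _, compact _,
    nonneg _ hκ.le, fun w hw => (bound _ w hw).2, ⟨u₀, pos _ hκ⟩, fun z => ?_, fun u => ?_⟩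
  · rw [polarExp_radialExt hα0 hα1 hPm hP0 hpP (hz _), hint]
    have : stableConst α * ((stableConst α * J)⁻¹ * J) = 1 := by field_simp
    rw [this, Complex.ofReal_one, one_mul]
  · rw [integral_radialExt_inv_smul (by simp), hint, hpP]
    field_simp

lemma integral_exp_neg_charExp_scaling (α : ℝ) (Λ : Measure (Sph d)) {r : ℝ} (hr : 0 < r)
    (u : Ed d) :
    ∫ z : Ed d, Complex.exp (-(Complex.I * (⟪r • u, z⟫ : ℂ))) *
        Complex.exp (- charExp d α Λ z) =
      (((r ^ d)⁻¹ : ℝ) : ℂ) * ∫ z : Ed d, Complex.exp (-(Complex.I * (⟪u, z⟫ : ℂ))) *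
        Complex.exp (-((r ^ (-α) : ℝ) * charExp d α Λ z)) := by
  have h := Measure.integral_comp_smul (volume : Measure (Ed d))
    (fun z : Ed d => Complex.exp (-(Complex.I * (⟪u, z⟫ : ℂ))) *
      Complex.exp (-((r ^ (-α) : ℝ) * charExp d α Λ z))) r
  rw [finrank_euclideanSpace_fin, abs_of_pos (by positivity), Complex.real_smul] at h
  rw [← h]
  congr 1
  funext z
  rw [charExp_smul α Λ hr, ← mul_assoc, ← Complex.ofReal_mul, ← Real.rpow_add hr,
    neg_add_cancel, Real.rpow_zero, Complex.ofReal_one, one_mul, real_inner_smul_left,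
    real_inner_smul_right]

end Density

/-- Tail asymptotics for `α ∈ (0,1)` with polynomial spectral density:
`g(x) = (2αΓ(α) sin(πα/2)/π) P(u_x)/|x|^{α+d} + O(|x|^{-2α-d})` as `|x| → ∞`. -/
theorem stmt10 (d : ℕ) (hd : 2 ≤ d) (α : ℝ) (hα0 : 0 < α) (hα1 : α < 1)
    (P : Sph d → ℝ) (hpoly : IsPolyRestriction d P) (hP0 : ∀ u, 0 ≤ P u) (hPne : P ≠ 0)
    (μ : Measure (Ed d)) [IsProbabilityMeasure μ]
    (hμ : IsStableChar d α (specMeasure d P) μ)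
    (g : Ed d → ℝ) (hg : IsDensityOf d α (specMeasure d P) g) :
    ∃ C R : ℝ, ∀ (x : Ed d) (hx : x ≠ 0), R ≤ ‖x‖ →
      |g x - 2 * α * Real.Gamma α * Real.sin (Real.pi * α / 2) / Real.pi *
          P (unitize x hx) / ‖x‖ ^ (α + d)| ≤ C * ‖x‖ ^ (-(2 * α + d)) := by
  have : NeZero d := ⟨by omega⟩
  obtain ⟨φ, hφ, hsupp, h0, hb, ⟨w₀, hw₀⟩, hΦ, hI⟩ :=
    exists_polar_density hα0 hα1 hpoly hP0 hPne
  obtain ⟨C, hC⟩ := exists_polar_expansion hφ hsupp h0 hb hw₀ hα0 hα1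
  refine ⟨((2 * π) ^ d)⁻¹ * C, 1, fun x hx hx1 => ?_⟩
  set r := ‖x‖ with hr
  have hr0 : 0 < r := norm_pos_iff.mpr hx
  set u := unitize x hx with hu
  have hxu : x = r • (u : Ed d) := by
    change x = r • (‖x‖⁻¹ • x)
    rw [smul_inv_smul₀ hr0.ne']
  have hmain := hC (r ^ (-α)) (by positivity) (Real.rpow_le_one_of_one_le_of_nonpos hx1
    (by linarith)) u (by simp)
  simp only [hΦ, hI u] at hmain
  have hgx := hg x
  rw [hxu, integral_exp_neg_charExp_scaling α _ hr0, ← hxu] at hgx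
  generalize (∫ z : Ed d, Complex.exp (-(Complex.I * (⟪(u : Ed d), z⟫ : ℂ))) *
        Complex.exp (-((r ^ (-α) : ℝ) * charExp d α (specMeasure d P) z))) = T at hmain hgx
  have hrα : r ^ (α + d) = r ^ α * r ^ d := by rw [Real.rpow_add hr0, Real.rpow_natCast]
  have hr2 : r ^ (-(2 * α + d)) = (r ^ d)⁻¹ * (r ^ (-α)) ^ 2 := by
    rw [← Real.rpow_natCast r d, ← Real.rpow_neg hr0.le, ← Real.rpow_natCast (r ^ (-α)) 2,
      ← Real.rpow_mul hr0.le, ← Real.rpow_add hr0]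
    congr 1
    push_cast
    ring
  have hA : 0 < (2 * π) ^ d := by positivity
  have key : ((g x - 2 * α * Real.Gamma α * Real.sin (π * α / 2) / π * P u /
      r ^ (α + d) : ℝ) : ℂ) = ((((2 * π) ^ d)⁻¹ * (r ^ d)⁻¹ : ℝ) : ℂ) *
        (T - ((r ^ (-α) : ℝ) : ℂ) * ((((2 * π) ^ d : ℝ) : ℂ) *
          (((stableConst α)⁻¹ * P u : ℝ) : ℂ))) := by
    have h1 : 2 * α * Real.Gamma α * Real.sin (π * α / 2) / π * P u / r ^ (α + d) =
        (((2 * π) ^ d)⁻¹ * (r ^ d)⁻¹) * (r ^ (-α) * ((2 * π) ^ d *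
          ((stableConst α)⁻¹ * P u))) := by
      rw [← inv_stableConst hα0 hα1, hrα, Real.rpow_neg hr0.le]
      have := (Real.rpow_pos_of_pos hr0 α).ne'
      have := (stableConst_pos hα0 hα1).ne'
      field_simp
    rw [h1, Complex.ofReal_sub, hgx]
    simp only [Complex.ofReal_mul]
    ring
  rw [← Real.norm_eq_abs, ← Complex.norm_real, key, norm_mul, Complex.norm_real, Real.norm_of_nonneg
    (by positivity), hr2]
  calc _ ≤ (((2 * π) ^ d)⁻¹ * (r ^ d)⁻¹) * (C * (r ^ (-α)) ^ 2) := by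
        gcongr
    _ = _ := by ring

end StablePaper
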